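/- arXiv:1707.03766 — 6 statements merged into one kernel-verified Lean document; each statement's English description precedes it below -/
import Mathlib

section
/- Let u be an arbitrary word and v, w nonempty words over V. Then u ↗ (vw) = Σ_{u=u¹u²} (u¹ ≻ v)(u² ↗ w), where vw and the juxtaposition on the right denote concatenation and the sum runs over all cuts of u (with the empty-word conventions for the quadri-algebra operations). -/
open Finset MonoidAlgebra TensorProduct

/-- `Sh(p,q)`: permutations of the `p+q` indices that are increasing on the
first `p` indices and on the last `q` indices. -/
def IsSh (p q : ℕ) (σ : Equiv.Perm (Fin (p + q))) : Prop :=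
  (∀ i j : Fin (p + q), (i : ℕ) < (j : ℕ) → (j : ℕ) < p → σ i < σ j) ∧
  (∀ i j : Fin (p + q), p ≤ (i : ℕ) → (i : ℕ) < (j : ℕ) → σ i < σ j)

instance IsSh.decPred (p q : ℕ) : DecidablePred (IsSh p q) := fun _ => by
  unfold IsSh; infer_instance

/-- The word `u_{σ⁻¹(1)} u_{σ⁻¹(2)} ⋯ u_{σ⁻¹(p+q)}` where `u₁ ⋯ u_p` is `u` and
`u_{p+1} ⋯ u_{p+q}` is `v`. -/
def shWord {V : Type*} (u v : List V) (σ : Equiv.Perm (Fin (u.length + v.length))) :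
    FreeMonoid V :=
  FreeMonoid.ofList
    (List.ofFn fun i => (u ++ v).get (Fin.cast (List.length_append (as := u) (bs := v)).symm (σ.symm i)))

/-- `posCond p b i` says that the letter at (combined) index `i` comes from the second
word (`b = true`, i.e. `p ≤ i`) or from the first word (`b = false`, i.e. `i < p`). -/
def posCond (p : ℕ) (b : Bool) (i : ℕ) : Prop :=
  match b with
  | true => p ≤ i
  | false => i < p

instance posCond.dec (p : ℕ) (b : Bool) (i : ℕ) : Decidable (posCond p b i) := by
  cases b <;> unfold posCond <;> infer_instance

variable (k : Type*) [CommRing k] {V : Type*}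

/-- The shuffle product `u ⧢ v` of two words, as an element of the monoid algebra
`H` of the free monoid on `V` (sum over all `(p,q)`-shuffles); in particular
`1 ⧢ a = a ⧢ 1 = a`. -/
noncomputable def shuffleProd (u v : List V) : MonoidAlgebra k (FreeMonoid V) :=
  ∑ σ ∈ univ.filter (IsSh u.length v.length),
    MonoidAlgebra.single (shWord u v σ) (1 : k)

/-- Generic quadri-algebra operation on words: the part of the shuffle product `u ⧢ v`
consisting of the shuffles where the first (resp. last) letter comes from `v` iff `fb`
(resp. `lb`) is `true`.  (For a shuffle permutation, the first letter comes from `v`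
iff `σ⁻¹(1) = p+1`, and from `u` iff `σ⁻¹(1) = 1`; the last letter comes from `v` iff
`σ⁻¹(p+q) = p+q`, and from `u` iff `σ⁻¹(p+q) = p`.)  This definition also encodes the
empty-word conventions: `1 ↘ a = a` and `a ↖ 1 = a` for nonempty `a`, and all other
quadri-algebra operations with an empty argument are `0`. -/
noncomputable def quadOp (fb lb : Bool) (u v : List V) : MonoidAlgebra k (FreeMonoid V) :=
  ∑ σ ∈ univ.filter (fun σ : Equiv.Perm (Fin (u.length + v.length)) =>
      IsSh u.length v.length σ ∧
      ∃ h : 0 < u.length + v.length,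
        posCond u.length fb (σ.symm ⟨0, h⟩) ∧
        posCond u.length lb (σ.symm ⟨u.length + v.length - 1, Nat.sub_lt h Nat.one_pos⟩)),
    MonoidAlgebra.single (shWord u v σ) (1 : k)

/-- `u ↘ v` : shuffles whose first and last letters come from `v`. -/
noncomputable def seOp (u v : List V) : MonoidAlgebra k (FreeMonoid V) := quadOp k true true u v

/-- `u ↗ v` : shuffles whose first letter comes from `v` and last letter from `u`. -/
noncomputable def neOp (u v : List V) : MonoidAlgebra k (FreeMonoid V) := quadOp k true false u v

/-- `u ↖ v` : shuffles whose first and last letters come from `u`. -/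
noncomputable def nwOp (u v : List V) : MonoidAlgebra k (FreeMonoid V) := quadOp k false false u v

/-- `u ↙ v` : shuffles whose first letter comes from `u` and last letter from `v`. -/
noncomputable def swOp (u v : List V) : MonoidAlgebra k (FreeMonoid V) := quadOp k false true u v

/-- `u ≻ v := u ↗ v + u ↘ v`. -/
noncomputable def succOp (u v : List V) : MonoidAlgebra k (FreeMonoid V) := neOp k u v + seOp k u v

/-- `u ≺ v := u ↖ v + u ↙ v`. -/
noncomputable def precOp (u v : List V) : MonoidAlgebra k (FreeMonoid V) := nwOp k u v + swOp k u v

/-- `u ∨ v := u ↘ v + u ↙ v`. -/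
noncomputable def veeOp (u v : List V) : MonoidAlgebra k (FreeMonoid V) := seOp k u v + swOp k u v

/-- `u ∧ v := u ↗ v + u ↖ v`. -/
noncomputable def wedgeOp (u v : List V) : MonoidAlgebra k (FreeMonoid V) := neOp k u v + nwOp k u v

/-- Recursive list of all shuffles of two lists. -/
def shl {A : Type*} : List A → List A → List (List A)
  | [], v => [v]
  | a :: u, [] => [a :: u]
  | a :: u, b :: v =>
      (shl u (b :: v)).map (List.cons a) ++ (shl (a :: u) v).map (List.cons b)
termination_by u v => u.length + v.length

theorem shl_nil_right {A : Type*} (u : List A) : shl u [] = [u] := by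
  cases u <;> simp [shl]

theorem shl_map {A B : Type*} (f : A → B) (u v : List A) :
    shl (u.map f) (v.map f) = (shl u v).map (List.map f) := by
  induction u, v using shl.induct with
  | case1 v => simp [shl]
  | case2 a u => simp [shl]
  | case3 a u b v ih1 ih2 =>
    simp only [List.map_cons] at ih1 ih2
    simp [shl, ih1, ih2, Function.comp_def]

theorem mem_shl {A : Type*} (p : A → Bool) (u v : List A) (hu : ∀ x ∈ u, p x = false)
    (hv : ∀ x ∈ v, p x = true) (l : List A) :
    l ∈ shl u v ↔ l.filter p = v ∧ l.filter (fun x => !p x) = u := by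
  induction u, v using shl.induct generalizing l with
  | case1 v =>
    simp only [shl, List.mem_singleton]
    constructor
    · rintro rfl
      refine ⟨List.filter_eq_self.2 hv, List.filter_eq_nil_iff.2 ?_⟩
      intro a ha; simp [hv a ha]
    · rintro ⟨h1, h2⟩
      rw [← h1, eq_comm, List.filter_eq_self]
      intro a ha
      simpa using List.filter_eq_nil_iff.1 h2 a ha
  | case2 a u =>
    simp only [shl, List.mem_singleton]
    constructor
    · rintro rfl
      refine ⟨List.filter_eq_nil_iff.2 ?_, List.filter_eq_self.2 ?_⟩
      · intro x hx; simp [hu x hx]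
      · intro x hx; simp [hu x hx]
    · rintro ⟨h1, h2⟩
      rw [← h2, eq_comm, List.filter_eq_self]
      intro a ha
      simpa using List.filter_eq_nil_iff.1 h1 a ha
  | case3 a u b v ih1 ih2 =>
    have ha := hu a (by simp)
    have hb := hv b (by simp)
    simp only [shl, List.mem_append, List.mem_map]
    cases l with
    | nil => simp
    | cons x l =>
      have i1 := ih1 (fun x hx => hu x (by simp [hx])) hv l
      have i2 := ih2 hu (fun x hx => hv x (by simp [hx])) l
      simp only [List.cons.injEq, existsAndEq, true_and, exists_eq_right_right, i1, i2]
      cases hx : p x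
      · simp only [List.filter_cons, hx]
        have : b ≠ x := by rintro rfl; simp [hb] at hx
        simp [this]; tauto
      · simp only [List.filter_cons, hx]
        have : a ≠ x := by rintro rfl; simp [ha] at hx
        simp [this]; tauto

theorem nodup_shl {A : Type*} (p : A → Bool) (u v : List A) (hu : ∀ x ∈ u, p x = false)
    (hv : ∀ x ∈ v, p x = true) : (shl u v).Nodup := by
  induction u, v using shl.induct with
  | case1 v => simp [shl]
  | case2 a u => simp [shl]
  | case3 a u b v ih1 ih2 =>
    have ha := hu a (by simp)
    have hb := hv b (by simp)
    rw [shl, List.nodup_append']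
    refine ⟨(ih1 (fun x hx => hu x (by simp [hx])) hv).map (List.cons_injective),
      (ih2 hu (fun x hx => hv x (by simp [hx]))).map (List.cons_injective), ?_⟩
    intro l h1 h2
    simp only [List.mem_map] at h1 h2
    obtain ⟨_, _, rfl⟩ := h1
    obtain ⟨_, _, h⟩ := h2
    simp only [List.cons.injEq] at h
    rw [← h.1, hb] at ha
    simp at ha

/-- A shuffle permutation as a list of indices. -/
def permList {n : ℕ} (σ : Equiv.Perm (Fin n)) : List (Fin n) := List.ofFn fun i => σ.symm i

theorem isSh_iff (p q : ℕ) (σ : Equiv.Perm (Fin (p + q))) :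
    IsSh p q σ ↔ permList σ ∈ shl (List.ofFn (Fin.castAdd q)) (List.ofFn (Fin.natAdd p)) := by
  rw [mem_shl (fun x : Fin (p + q) => decide (p ≤ (x : ℕ))) _ _ (by simp) (by simp)]
  have hperm : (permList σ).Perm (List.ofFn (Fin.castAdd q) ++ List.ofFn (Fin.natAdd p)) := by
    rw [List.perm_ext_iff_of_nodup]
    · intro a
      have h1 : a ∈ permList σ := by
        simp only [permList, List.mem_ofFn]
        exact ⟨σ a, by simp⟩
      have h2 : a ∈ List.ofFn (Fin.castAdd q) ++ List.ofFn (Fin.natAdd (m := q) p) := by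
        simp only [List.mem_append, List.mem_ofFn]
        refine Fin.addCases (fun i => Or.inl ⟨i, rfl⟩) (fun i => Or.inr ⟨i, rfl⟩) a
      simp [h1, h2]
    · exact List.nodup_ofFn.2 σ.symm.injective
    · rw [List.nodup_append']
      refine ⟨List.nodup_ofFn.2 (Fin.castAdd_injective _ _),
        List.nodup_ofFn.2 (Fin.natAdd_injective _ _), ?_⟩
      intro a h1 h2
      simp only [List.mem_ofFn] at h1 h2
      obtain ⟨i, rfl⟩ := h1
      obtain ⟨j, h⟩ := h2
      have := congrArg Fin.val h
      simp at this
      omega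
  have key : ∀ r : Fin (p + q) → Bool, (permList σ |>.filter r).Pairwise (· < ·) ↔
      ∀ i j : Fin (p + q), r i = true → r j = true → i < j → σ i < σ j := by
    intro r
    rw [List.pairwise_filter, permList, List.pairwise_ofFn]
    constructor
    · intro h i j hi hj hij
      by_contra hc
      have hne : σ i ≠ σ j := fun e => hij.ne (σ.injective e)
      have := h (i := σ j) (j := σ i) (lt_of_le_of_ne (not_lt.1 hc) hne.symm)
        (by simpa using hj) (by simpa using hi)
      simp at this
      exact absurd this (not_lt.2 hij.le)
    · intro h i j hij hi hj
      by_contra hc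
      have hne : σ.symm i ≠ σ.symm j := fun e => hij.ne (σ.symm.injective e)
      have := h _ _ hj hi (lt_of_le_of_ne (not_lt.1 hc) hne.symm)
      simp at this
      exact absurd this (not_lt.2 hij.le)
  have e1 : ∀ r : Fin (p + q) → Bool, ∀ t : List (Fin (p + q)), t.Pairwise (· < ·) →
      (List.ofFn (Fin.castAdd q) ++ List.ofFn (Fin.natAdd p)).filter r = t →
      ((permList σ).filter r = t ↔ 
      ∀ i j : Fin (p + q), r i = true → r j = true → i < j → σ i < σ j) := by
    intro r t ht hr
    rw [← key]
    constructor
    · intro h; rw [h]; exact ht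
    · intro h
      have := hperm.filter r
      rw [hr] at this
      exact this.eq_of_pairwise (fun a b _ _ h1 h2 => absurd h1 (not_lt.2 h2.le)) h ht
  rw [e1 _ _ (by rw [List.pairwise_ofFn]; intro i j h; simpa using h), 
    e1 _ _ (by rw [List.pairwise_ofFn]; intro i j h; exact h)]
  · simp only [IsSh, decide_eq_true_eq, Bool.not_eq_true', decide_eq_false_iff_not, not_le]
    constructor
    · rintro ⟨h1, h2⟩
      exact ⟨fun i j hi hj hij => h2 i j hi hij, fun i j hi hj hij => h1 i j hij hj⟩
    · rintro ⟨h1, h2⟩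
      exact ⟨fun i j hij hj => h2 i j (lt_trans hij hj) hj hij,
        fun i j hi hij => h1 i j hi (le_trans hi hij.le) hij⟩
  · rw [List.filter_append, List.filter_eq_self.2, (List.filter_eq_nil_iff).2, List.append_nil]
    · simp
    · simp
  · rw [List.filter_append, List.filter_eq_nil_iff.2, (List.filter_eq_self).2, List.nil_append]
    · simp
    · simp

theorem permList_injective {n : ℕ} : Function.Injective (permList (n := n)) := by
  intro σ τ h
  have := List.ofFn_injective h
  have h2 : σ.symm = τ.symm := Equiv.ext fun i => congrFun this i
  simpa using congrArg Equiv.symm h2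

theorem exists_permList {n : ℕ} (l : List (Fin n)) (h : l.Perm (List.finRange n)) :
    ∃ σ, permList σ = l := by
  have hl : l.length = n := by simpa using h.length_eq
  have hn : l.Nodup := h.nodup_iff.2 (List.nodup_finRange n)
  have hinj : Function.Injective (fun i : Fin n => l.get (Fin.cast hl.symm i)) := by
    intro i j hij
    have := List.nodup_iff_injective_get.1 hn hij
    simpa using this
  refine ⟨(Equiv.ofBijective _ (Finite.injective_iff_bijective.1 hinj)).symm, ?_⟩
  simp only [permList, Equiv.symm_symm, Equiv.ofBijective_apply]
  apply List.ext_get <;> simp [hl]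

theorem shl_perm {A : Type*} (u v l : List A) (h : l ∈ shl u v) : l.Perm (u ++ v) := by
  induction u, v using shl.induct generalizing l with
  | case1 v => simp [shl] at h; simp [h]
  | case2 a u => simp [shl] at h; simp [h]
  | case3 a u b v ih1 ih2 =>
    simp only [shl, List.mem_append, List.mem_map] at h
    rcases h with ⟨t, ht, rfl⟩ | ⟨t, ht, rfl⟩
    · exact (ih1 t ht).cons a
    · exact ((ih2 t ht).cons b).trans List.perm_middle.symm

theorem bridge {M : Type*} [AddCommMonoid M] (p q : ℕ) (f : List (Fin (p + q)) → M) :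
    ∑ σ ∈ univ.filter (IsSh p q), f (permList σ) =
      ((shl (List.ofFn (Fin.castAdd q)) (List.ofFn (Fin.natAdd p))).map f).sum := by
  have hnd := nodup_shl (fun x : Fin (p + q) => decide (p ≤ (x : ℕ)))
    (List.ofFn (Fin.castAdd q)) (List.ofFn (Fin.natAdd p)) (by simp) (by simp)
  rw [← List.sum_toFinset _ hnd]
  refine Finset.sum_bij (fun σ _ => permList σ) ?_ ?_ ?_ ?_
  · intro σ hσ
    simpa using (isSh_iff p q σ).1 (by simpa using hσ)
  · intro σ _ τ _ h
    exact permList_injective h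
  · intro l hl
    have hl : l ∈ shl (List.ofFn (Fin.castAdd q)) (List.ofFn (Fin.natAdd p)) := by simpa using hl
    obtain ⟨σ, rfl⟩ := exists_permList l (by
      have h1 := shl_perm _ _ _ hl
      have : List.finRange (p + q) = List.ofFn (Fin.castAdd q) ++ List.ofFn (Fin.natAdd p) := by
        rw [← List.ofFn_id, List.ofFn_add]
        simp
        rfl
      rwa [this])
    exact ⟨σ, by simpa using (isSh_iff p q σ).2 hl, rfl⟩
  · intros; rfl

/-- contribution of a labelled word -/
noncomputable def contrib (fb lb : Bool) (l : List (V × Bool)) : MonoidAlgebra k (FreeMonoid V) :=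
  if l.head?.map Prod.snd = some fb ∧ l.getLast?.map Prod.snd = some lb then
    MonoidAlgebra.single (FreeMonoid.ofList (l.map Prod.fst)) 1 else 0

theorem posCond_iff (p : ℕ) (b : Bool) (i : ℕ) : posCond p b i ↔ decide (p ≤ i) = b := by
  cases b <;> simp [posCond]

theorem quadOp_eq (fb lb : Bool) (u v : List V) :
    quadOp k fb lb u v = ((shl (u.map (·, false)) (v.map (·, true))).map (contrib k fb lb)).sum := by
  set φ : Fin (u.length + v.length) → V × Bool := fun x =>
    ((u ++ v).get (Fin.cast (List.length_append (as := u) (bs := v)).symm x),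
      decide (u.length ≤ (x : ℕ))) with hφ
  have h1 : u.map (·, false) = (List.ofFn (Fin.castAdd v.length)).map φ := by
    apply List.ext_getElem <;> simp [hφ]
    intro i hi; simp [hi]
  have h2 : v.map (·, true) = (List.ofFn (Fin.natAdd u.length)).map φ := by
    apply List.ext_getElem <;> simp [hφ]
  rw [h1, h2, shl_map, List.map_map, ← bridge]
  rw [quadOp, ← Finset.filter_filter, Finset.sum_filter]
  refine Finset.sum_congr rfl fun σ _ => ?_
  simp only [Function.comp, contrib]
  have hw : FreeMonoid.ofList (((permList σ).map φ).map Prod.fst) = shWord u v σ := by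
    simp [permList, shWord, hφ, Function.comp_def]
  rw [hw]
  congr 1
  rw [eq_iff_iff]
  by_cases h0 : 0 < u.length + v.length
  · have e1 : ((permList σ).map φ).head? = some (φ (σ.symm ⟨0, h0⟩)) := by
      rw [List.head?_eq_getElem?]
      simp [permList, h0]
    have e2 : ((permList σ).map φ).getLast? = some (φ (σ.symm ⟨u.length + v.length - 1, Nat.sub_lt h0 Nat.one_pos⟩)) := by
      rw [List.getLast?_eq_getElem?]
      simp [permList, h0]
    rw [e1, e2]
    simp only [h0, exists_true_left, posCond_iff, hφ, Option.map_some, Option.some.injEq]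
  · have : ((permList σ).map φ) = [] := by
      apply List.eq_nil_of_length_eq_zero
      rw [List.length_map, permList, List.length_ofFn]; omega
    rw [this]
    simp [h0]

theorem shl_split_nil {A M : Type*} [AddCommMonoid M] (f : List A → M) (u w : List A) (b : A) :
    ((shl u (b :: w)).map f).sum = ∑ i ∈ Finset.range (u.length + 1),
        ((shl (u.drop i) w).map fun l₂ => f (u.take i ++ b :: l₂)).sum := by
  induction u generalizing f with
  | nil => simp [shl]
  | cons a u ih =>
    rw [shl, List.map_append, List.sum_append, List.map_map, List.map_map, ih, List.length_cons,
      Finset.sum_range_succ' _ (u.length + 1)]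
    simp [Function.comp_def]

theorem shl_split {A M : Type*} [AddCommMonoid M] (f : List A → M) (u v w : List A) (b : A) :
    ((shl u (v ++ b :: w)).map f).sum = ∑ i ∈ Finset.range (u.length + 1),
      ((shl (u.take i) v).map fun l₁ =>
        ((shl (u.drop i) w).map fun l₂ => f (l₁ ++ b :: l₂)).sum).sum := by
  induction u, v using shl.induct generalizing f with
  | case1 v => simp [shl]
  | case2 a u =>
    simp [shl_split_nil, shl_nil_right]
  | case3 a u c v ih1 ih2 =>
    rw [List.cons_append, shl, List.map_append, List.sum_append, List.map_map, List.map_map]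
    rw [← List.cons_append, ih1, ih2, List.length_cons]
    rw [Finset.sum_range_succ' _ (u.length + 1), Finset.sum_range_succ' _ (u.length + 1),
      ← add_assoc, ← Finset.sum_add_distrib]
    congr 1
    · refine Finset.sum_congr rfl fun i _ => ?_
      simp [shl, Function.comp_def]
    · simp [shl, Function.comp_def]

theorem shl_first {M : Type*} [AddCommMonoid M] (g : List (V × Bool) → M)
    (hg : ∀ a l, g ((a, false) :: l) = 0) (u : List V) (v : List (V × Bool)) (c : V × Bool) :
    ((shl (u.map (·, false)) (c :: v)).map g).sum =
      ((shl (u.map (·, false)) v).map fun l => g (c :: l)).sum := by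
  cases u with
  | nil => simp [shl]
  | cons a u => simp [shl, Function.comp_def, hg]

theorem succOp_cons (u v : List V) (c : V) :
    succOp k u (c :: v) = ((shl (u.map (·, false)) (v.map (·, true))).map fun l =>
      MonoidAlgebra.single (FreeMonoid.ofList (c :: l.map Prod.fst)) (1 : k)).sum := by
  rw [succOp, neOp, seOp, quadOp_eq, quadOp_eq, List.map_cons,
    shl_first _ (by intro a l; simp [contrib]), shl_first _ (by intro a l; simp [contrib]),
    ← List.sum_map_add]
  congr 1
  refine List.map_congr_left fun l _ => ?_
  have h : ∃ x, ((c, true) :: l).getLast? = some x := ⟨_, List.getLast?_cons⟩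
  obtain ⟨⟨x, y⟩, h⟩ := h
  simp only [contrib, h]
  cases y <;> simp

theorem neOp_cons (u v : List V) (c : V) :
    neOp k u (c :: v) = ((shl (u.map (·, false)) (v.map (·, true))).map fun l =>
      contrib k true false ((c, true) :: l)).sum := by
  rw [neOp, quadOp_eq, List.map_cons, shl_first _ (by intro a l; simp [contrib])]

theorem statement1 (u v w : List V) (hv : v ≠ []) (hw : w ≠ []) :
    neOp k u (v ++ w) =
      ∑ i ∈ Finset.range (u.length + 1),
        succOp k (u.take i) v * neOp k (u.drop i) w := by
  obtain ⟨c, v, rfl⟩ := List.exists_cons_of_ne_nil hv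
  obtain ⟨b, w, rfl⟩ := List.exists_cons_of_ne_nil hw
  rw [List.cons_append, neOp_cons, List.map_append, List.map_cons, shl_split, List.length_map]
  refine Finset.sum_congr rfl fun i _ => ?_
  rw [succOp_cons, neOp_cons, ← List.map_take, ← List.map_drop, ← List.sum_map_mul_right]
  congr 1
  refine List.map_congr_left fun l₁ _ => ?_
  rw [← List.sum_map_mul_left]
  congr 1
  refine List.map_congr_left fun l₂ _ => ?_
  have : ((c, true) :: (l₁ ++ (b, true) :: l₂)).getLast? = ((b, true) :: l₂).getLast? := by
    rw [← List.cons_append, List.getLast?_append]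
    simp [List.getLast?_cons]
  simp only [contrib, this]
  simp only [List.head?_cons, Option.map_some, true_and, mul_ite, mul_zero]
  congr 1
  rw [MonoidAlgebra.single_mul_single, ← FreeMonoid.ofList_append]
  simp
end

section
/- Let u be an arbitrary word and v, w nonempty words over V. Then u ↘ (vw) = Σ_{u=u¹u²} (u¹ ↘ v)(u² ∨ w), where vw and the juxtaposition on the right denote concatenation and the sum runs over all cuts of u (with the empty-word conventions for the quadri-algebra operations). -/
open Finset MonoidAlgebra TensorProduct

variable (k : Type*) [CommRing k] {V : Type*}

/-- Merge two lists following a pattern (`true`: take from the second list). -/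
def mrg {α : Type*} : List Bool → List α → List α → List α
  | true :: b, u, y :: v => y :: mrg b u v
  | false :: b, x :: u, v => x :: mrg b u v
  | _, _, _ => []

lemma mrg_filter {α : Type*} (P : α → Bool) (l : List α) :
    mrg (l.map P) (l.filter (fun x => !P x)) (l.filter P) = l := by
  induction l with
  | nil => simp [mrg]
  | cons a l ih =>
    cases h : P a <;> simp [h, mrg, ih]

lemma mrg_map {α β : Type*} (f : α → β) (b : List Bool) (u v : List α) :
    (mrg b u v).map f = mrg b (u.map f) (v.map f) := by
  induction b generalizing u v with
  | nil => simp [mrg]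
  | cons c b ih => cases c <;> cases u <;> cases v <;> simp [mrg, ih]

lemma mrg_spec {α : Type*} (P : α → Bool) (b : List Bool) (u v : List α)
    (hu : ∀ x ∈ u, P x = false) (hv : ∀ x ∈ v, P x = true)
    (h0 : b.count false = u.length) (h1 : b.count true = v.length) :
    (mrg b u v).map P = b ∧ (mrg b u v).filter (fun x => !P x) = u ∧
      (mrg b u v).filter P = v := by
  induction b generalizing u v with
  | nil =>
    simp at h0 h1
    have h0 := List.eq_nil_of_length_eq_zero h0.symm
    have h1 := List.eq_nil_of_length_eq_zero h1.symm
    subst h0 h1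
    simp [mrg]
  | cons c b ih =>
    cases c
    · cases u with
      | nil => simp at h0
      | cons x u =>
        have := ih u v (fun y hy => hu y (by simp [hy])) hv (by simpa using h0) (by simpa using h1)
        have hx := hu x (by simp)
        simp [mrg, hx, this]
    · cases v with
      | nil => simp at h1
      | cons x v =>
        have := ih u v hu (fun y hy => hv y (by simp [hy])) (by simpa using h0) (by simpa using h1)
        have hx := hv x (by simp)
        simp [mrg, hx, this]

/-- the index lists -/
def idx0 (p q : ℕ) : List (Fin (p + q)) := List.ofFn (fun i : Fin p => Fin.castAdd q i)
def idx1 (p q : ℕ) : List (Fin (p + q)) := List.ofFn (fun i : Fin q => Fin.natAdd p i)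
def isSnd (p q : ℕ) (x : Fin (p + q)) : Bool := decide (p ≤ (x : ℕ))

lemma idx0_sorted (p q : ℕ) : (idx0 p q).Pairwise (· < ·) := by
  rw [idx0, List.pairwise_ofFn]; intro i j h; exact h

lemma idx1_sorted (p q : ℕ) : (idx1 p q).Pairwise (· < ·) := by
  rw [idx1, List.pairwise_ofFn]; intro i j h; simpa using h

lemma mem_idx0 (p q : ℕ) (x : Fin (p + q)) : x ∈ idx0 p q ↔ isSnd p q x = false := by
  simp only [idx0, List.mem_ofFn, isSnd, decide_eq_false_iff_not, not_le]
  constructor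
  · rintro ⟨i, rfl⟩; simp
  · intro h; exact ⟨⟨x, h⟩, by ext; simp⟩

lemma mem_idx1 (p q : ℕ) (x : Fin (p + q)) : x ∈ idx1 p q ↔ isSnd p q x = true := by
  simp only [idx1, List.mem_ofFn, isSnd, decide_eq_true_eq]
  constructor
  · rintro ⟨i, rfl⟩; simp
  · intro h; exact ⟨⟨x - p, by omega⟩, by ext; simp; omega⟩

lemma isSh_iff_s2 (p q : ℕ) (σ : Equiv.Perm (Fin (p + q))) :
    IsSh p q σ ↔
      (List.ofFn σ.symm).filter (fun x => !isSnd p q x) = idx0 p q ∧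
      (List.ofFn σ.symm).filter (isSnd p q) = idx1 p q := by
  have nd : (List.ofFn σ.symm).Nodup := List.nodup_ofFn.2 σ.symm.injective
  have hm : ∀ x, x ∈ List.ofFn σ.symm := fun x => by
    rw [List.mem_ofFn]; exact ⟨σ x, by simp⟩
  constructor
  · rintro ⟨h0, h1⟩
    constructor
    · refine List.Perm.eq_of_pairwise (le := (· < ·)) (fun a b _ _ h h' => absurd h' h.asymm) ?_
        (idx0_sorted p q) ?_
      · rw [List.pairwise_filter, List.pairwise_ofFn]
        intro i j hij hi hj
        simp [isSnd] at hi hj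
        by_contra hc
        rcases (not_lt.1 hc).lt_or_eq with h | h
        · have := h0 _ _ h hi
          simp at this; exact absurd this hij.asymm
        · exact hij.ne (σ.symm.injective h.symm)
      · rw [List.perm_ext_iff_of_nodup (nd.filter _) ((idx0_sorted p q).imp fun h => h.ne)]
        intro a
        rw [mem_idx0, List.mem_filter]; simp [hm]
    · refine List.Perm.eq_of_pairwise (le := (· < ·)) (fun a b _ _ h h' => absurd h' h.asymm) ?_
        (idx1_sorted p q) ?_
      · rw [List.pairwise_filter, List.pairwise_ofFn]
        intro i j hij hi hj
        simp [isSnd] at hi hj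
        by_contra hc
        rcases (not_lt.1 hc).lt_or_eq with h | h
        · have := h1 _ _ hj h
          simp at this; exact absurd this hij.asymm
        · exact hij.ne (σ.symm.injective h.symm)
      · rw [List.perm_ext_iff_of_nodup (nd.filter _) ((idx1_sorted p q).imp fun h => h.ne)]
        intro a
        rw [mem_idx1, List.mem_filter]; simp [hm]
  · rintro ⟨h0, h1⟩
    have s0 := idx0_sorted p q
    have s1 := idx1_sorted p q
    rw [← h0, List.pairwise_filter, List.pairwise_ofFn] at s0
    rw [← h1, List.pairwise_filter, List.pairwise_ofFn] at s1
    constructor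
    · intro i j hij hj
      by_contra hc
      rcases (not_lt.1 hc).lt_or_eq with h | h
      · have := s0 h (by simp [isSnd]; omega) (by simp [isSnd]; omega)
        simp at this; omega
      · have := σ.injective h; subst this; omega
    · intro i j hi hij
      by_contra hc
      rcases (not_lt.1 hc).lt_or_eq with h | h
      · have := s1 h (by simp [isSnd]; omega) (by simp [isSnd]; omega)
        simp at this; omega
      · have := σ.injective h; subst this; omega

lemma idx0_map {α : Type*} (u v : List α) :
    (idx0 u.length v.length).map
      (fun i => (u ++ v).get (Fin.cast (List.length_append (as := u) (bs := v)).symm i)) = u := by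
  rw [idx0, List.map_ofFn]
  conv_rhs => rw [← List.ofFn_get u]
  congr 1; funext i
  simp

lemma idx1_map {α : Type*} (u v : List α) :
    (idx1 u.length v.length).map
      (fun i => (u ++ v).get (Fin.cast (List.length_append (as := u) (bs := v)).symm i)) = v := by
  rw [idx1, List.map_ofFn]
  conv_rhs => rw [← List.ofFn_get v]
  congr 1; funext i
  simp

lemma isSh_mrg {p q : ℕ} {σ : Equiv.Perm (Fin (p + q))} (h : IsSh p q σ) :
    mrg (List.ofFn fun i => isSnd p q (σ.symm i)) (idx0 p q) (idx1 p q) = List.ofFn σ.symm := by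
  rw [isSh_iff_s2] at h
  have := mrg_filter (isSnd p q) (List.ofFn σ.symm)
  rw [h.1, h.2, List.map_ofFn] at this
  exact this

lemma shWord_eq (u v : List V) (σ : Equiv.Perm (Fin (u.length + v.length)))
    (h : IsSh u.length v.length σ) :
    shWord u v σ = FreeMonoid.ofList
      (mrg (List.ofFn fun i => isSnd u.length v.length (σ.symm i)) u v) := by
  have := congrArg (List.map (fun i => (u ++ v).get
    (Fin.cast (List.length_append (as := u) (bs := v)).symm i))) (isSh_mrg h)
  rw [mrg_map, idx0_map, idx1_map, List.map_ofFn] at this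
  rw [this]; rfl

lemma isSh_count {p q : ℕ} {σ : Equiv.Perm (Fin (p + q))} (h : IsSh p q σ) :
    (List.ofFn fun i => isSnd p q (σ.symm i)).count false = p ∧
    (List.ofFn fun i => isSnd p q (σ.symm i)).count true = q := by
  rw [isSh_iff_s2] at h
  have e : (List.ofFn fun i => isSnd p q (σ.symm i)) = (List.ofFn σ.symm).map (isSnd p q) := by
    rw [List.map_ofFn]; rfl
  rw [e]
  have h0 := congrArg List.length h.1
  have h1 := congrArg List.length h.2
  simp only [idx0, idx1, List.length_ofFn] at h0 h1
  constructor
  · conv_rhs => rw [← h0]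
    rw [List.count, List.countP_map, List.countP_eq_length_filter]
    congr 2; funext x; simp
  · conv_rhs => rw [← h1]
    rw [List.count, List.countP_map, List.countP_eq_length_filter]
    congr 2; funext x; simp

lemma exists_isSh (p q : ℕ) (b : Fin (p + q) → Bool) (h0 : (List.ofFn b).count false = p)
    (h1 : (List.ofFn b).count true = q) :
    ∃ σ : Equiv.Perm (Fin (p + q)), IsSh p q σ ∧ (fun i => isSnd p q (σ.symm i)) = b := by
  obtain ⟨hb, hf0, hf1⟩ := mrg_spec (isSnd p q) (List.ofFn b) (idx0 p q) (idx1 p q)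
    (fun x hx => (mem_idx0 p q x).1 hx) (fun x hx => (mem_idx1 p q x).1 hx)
    (by rw [h0]; simp [idx0]) (by rw [h1]; simp [idx1])
  generalize hl : mrg (List.ofFn b) (idx0 p q) (idx1 p q) = l at hb hf0 hf1
  have hlen : l.length = p + q := by
    have := congrArg List.length hb; simpa using this
  let f : Fin (p + q) → Fin (p + q) := fun i => l.get (Fin.cast hlen.symm i)
  have hf : List.ofFn f = l := by
    apply List.ext_get
    · simp [hlen]
    · intro n _ _; simp [f]
  have hmem : ∀ x, x ∈ l := by
    intro x
    cases hx : isSnd p q x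
    · have := (mem_idx0 p q x).2 hx
      rw [← hf0] at this; exact List.mem_of_mem_filter this
    · have := (mem_idx1 p q x).2 hx
      rw [← hf1] at this; exact List.mem_of_mem_filter this
  have hsurj : Function.Surjective f := fun x => by
    have := hmem x
    rw [← hf, List.mem_ofFn] at this; exact this
  have hbij : Function.Bijective f := Finite.surjective_iff_bijective.1 hsurj
  refine ⟨(Equiv.ofBijective f hbij).symm, ?_, ?_⟩
  · rw [isSh_iff_s2]
    have : List.ofFn (Equiv.ofBijective f hbij).symm.symm = l := hf
    rw [this]; exact ⟨hf0, hf1⟩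
  · apply List.ofFn_injective
    rw [← hb, ← hf, List.map_ofFn]; rfl

open Classical in
/-- Sum over patterns of length `n` satisfying `Q`. -/
noncomputable def pSum (n : ℕ) (Q : List Bool → Prop) (u v : List V) :
    MonoidAlgebra k (FreeMonoid V) :=
  ∑ b : Fin n → Bool,
    if (List.ofFn b).count false = u.length ∧ (List.ofFn b).count true = v.length ∧
        Q (List.ofFn b) then
      MonoidAlgebra.single (FreeMonoid.ofList (mrg (List.ofFn b) u v)) (1 : k) else 0

lemma posCond_iff_s2 (p q : ℕ) (c : Bool) (x : Fin (p + q)) :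
    posCond p c x ↔ isSnd p q x = c := by
  cases c <;> simp [posCond, isSnd]

open Classical in
lemma pSum_filter (n : ℕ) (Q : List Bool → Prop) (u v : List V) :
    pSum k n Q u v = ∑ b ∈ univ.filter (fun b : Fin n → Bool =>
      (List.ofFn b).count false = u.length ∧ (List.ofFn b).count true = v.length ∧
        Q (List.ofFn b)),
      MonoidAlgebra.single (FreeMonoid.ofList (mrg (List.ofFn b) u v)) (1 : k) := by
  rw [pSum, ← Finset.sum_filter]

lemma quadOp_eq_s2 (fb lb : Bool) (u v : List V) :
    quadOp k fb lb u v = pSum k (u.length + v.length)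
      (fun b => b.head? = some fb ∧ b.getLast? = some lb) u v := by
  classical
  have key : ∀ σ : Equiv.Perm (Fin (u.length + v.length)),
      (∃ h : 0 < u.length + v.length,
        posCond u.length fb (σ.symm ⟨0, h⟩) ∧
        posCond u.length lb (σ.symm ⟨u.length + v.length - 1, Nat.sub_lt h Nat.one_pos⟩)) ↔
      ((List.ofFn fun i => isSnd u.length v.length (σ.symm i)).head? = some fb ∧
       (List.ofFn fun i => isSnd u.length v.length (σ.symm i)).getLast? = some lb) := by
    intro σ
    simp only [posCond_iff_s2]
    rw [List.head?_eq_getElem?, List.getLast?_eq_getElem?]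
    simp only [List.getElem?_ofFn, List.length_ofFn]
    constructor
    · rintro ⟨h, h0, h1⟩
      have h' : u.length + v.length - 1 < u.length + v.length := by omega
      rw [dif_pos h, dif_pos h', h0, h1]; simp
    · rintro ⟨h0, h1⟩
      by_cases h : 0 < u.length + v.length
      · have h' : u.length + v.length - 1 < u.length + v.length := by omega
        rw [dif_pos h] at h0
        rw [dif_pos h'] at h1
        exact ⟨h, by simpa using h0, by simpa using h1⟩
      · rw [dif_neg h] at h0; simp at h0
  generalize hQ : (fun b : List Bool => b.head? = some fb ∧ b.getLast? = some lb) = Q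
  replace key := fun σ => (key σ).trans (iff_of_eq (congrFun hQ _))
  rw [quadOp, pSum_filter]
  refine Finset.sum_bij (fun σ _ => fun i => isSnd u.length v.length (σ.symm i)) ?_ ?_ ?_ ?_
  · intro σ hσ
    rw [Finset.mem_filter] at hσ ⊢
    obtain ⟨_, h, h'⟩ := hσ
    exact ⟨Finset.mem_univ _, (isSh_count h).1, (isSh_count h).2, (key σ).1 h'⟩
  · intro σ hσ τ hτ hst
    rw [Finset.mem_filter] at hσ hτ
    have h1 := isSh_mrg hσ.2.1
    have h2 := isSh_mrg hτ.2.1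
    rw [hst, h2] at h1
    have := List.ofFn_injective h1
    have h3 : τ.symm = σ.symm := DFunLike.coe_injective this
    rw [← Equiv.symm_symm σ, ← h3, Equiv.symm_symm]
  · intro b hb
    rw [Finset.mem_filter] at hb
    obtain ⟨_, h0, h1, h2⟩ := hb
    obtain ⟨σ, hσ, rfl⟩ := exists_isSh _ _ b h0 h1
    exact ⟨σ, by rw [Finset.mem_filter]; exact ⟨Finset.mem_univ _, hσ, (key σ).2 h2⟩, rfl⟩
  · intro σ hσ
    rw [Finset.mem_filter] at hσ
    rw [shWord_eq u v σ hσ.2.1]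

lemma sum_cons {M : Type*} [AddCommMonoid M] (n : ℕ) (F : List Bool → M) :
    ∑ b : Fin (n + 1) → Bool, F (List.ofFn b) =
      ∑ b : Fin n → Bool, F (true :: List.ofFn b) +
      ∑ b : Fin n → Bool, F (false :: List.ofFn b) := by
  rw [← (Fin.consEquiv (fun _ : Fin (n + 1) => Bool)).sum_comp, Fintype.sum_prod_type]
  simp [Fin.consEquiv]

/-- Shuffles ending with a letter of the second word (or empty). -/
noncomputable def aSum (u v : List V) : MonoidAlgebra k (FreeMonoid V) :=
  pSum k (u.length + v.length) (fun b => b.getLast? ≠ some false) u v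

/-- A letter as an element of the algebra. -/
noncomputable def ltr (x : V) : MonoidAlgebra k (FreeMonoid V) :=
  MonoidAlgebra.single (FreeMonoid.ofList [x]) 1

lemma ltr_mul (x : V) (l : List V) :
    MonoidAlgebra.single (FreeMonoid.ofList (x :: l)) (1 : k) =
      ltr k x * MonoidAlgebra.single (FreeMonoid.ofList l) 1 := by
  rw [ltr, MonoidAlgebra.single_mul_single, ← FreeMonoid.ofList_append]; simp

lemma pSum_zero (Q : List Bool → Prop) (hQ : Q []) : pSum k 0 Q ([] : List V) [] = 1 := by
  simp [pSum, hQ, mrg]; rfl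

lemma pSum_congr {n : ℕ} {Q Q' : List Bool → Prop} {u v : List V}
    (h : ∀ b : List Bool, b.length = n → b.count false = u.length → b.count true = v.length →
      (Q b ↔ Q' b)) :
    pSum k n Q u v = pSum k n Q' u v := by
  classical
  unfold pSum
  refine Finset.sum_congr rfl fun b _ => ?_
  refine if_congr ?_ rfl rfl
  constructor
  · rintro ⟨h0, h1, h2⟩; exact ⟨h0, h1, (h _ (by simp) h0 h1).1 h2⟩
  · rintro ⟨h0, h1, h2⟩; exact ⟨h0, h1, (h _ (by simp) h0 h1).2 h2⟩

lemma pSum_false {n : ℕ} {Q : List Bool → Prop} {u v : List V}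
    (h : ∀ b : List Bool, b.length = n → b.count false = u.length → b.count true = v.length → ¬ Q b) :
    pSum k n Q u v = 0 := by
  classical
  unfold pSum
  refine Finset.sum_eq_zero fun b _ => if_neg ?_
  rintro ⟨h0, h1, h2⟩; exact h _ (by simp) h0 h1 h2

lemma pSum_succ_nil_right (n : ℕ) (Q : List Bool → Prop) (x : V) (u : List V) :
    pSum k (n + 1) Q (x :: u) [] = ltr k x * pSum k n (fun b => Q (false :: b)) u [] := by
  classical
  unfold pSum
  rw [sum_cons n (fun l => if l.count false = (x :: u).length ∧ l.count true = ([] : List V).length ∧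
    Q l then MonoidAlgebra.single (FreeMonoid.ofList (mrg l (x :: u) [])) (1 : k) else 0)]
  simp [-FreeMonoid.ofList_cons, mrg, ltr_mul, Finset.mul_sum, mul_ite]

lemma pSum_succ_nil_left (n : ℕ) (Q : List Bool → Prop) (y : V) (v : List V) :
    pSum k (n + 1) Q [] (y :: v) = ltr k y * pSum k n (fun b => Q (true :: b)) [] v := by
  classical
  unfold pSum
  rw [sum_cons n (fun l => if l.count false = ([] : List V).length ∧ l.count true = (y :: v).length ∧
    Q l then MonoidAlgebra.single (FreeMonoid.ofList (mrg l [] (y :: v))) (1 : k) else 0)]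
  simp [-FreeMonoid.ofList_cons, mrg, ltr_mul, Finset.mul_sum, mul_ite]

lemma pSum_succ_cons (n : ℕ) (Q : List Bool → Prop) (x y : V) (u v : List V) :
    pSum k (n + 1) Q (x :: u) (y :: v) =
      ltr k x * pSum k n (fun b => Q (false :: b)) u (y :: v) +
      ltr k y * pSum k n (fun b => Q (true :: b)) (x :: u) v := by
  classical
  unfold pSum
  rw [sum_cons n (fun l => if l.count false = (x :: u).length ∧ l.count true = (y :: v).length ∧
    Q l then MonoidAlgebra.single (FreeMonoid.ofList (mrg l (x :: u) (y :: v))) (1 : k) else 0)]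
  simp [-FreeMonoid.ofList_cons, mrg, ltr_mul, Finset.mul_sum, mul_ite]
  rw [add_comm]

lemma pSum_add {n : ℕ} (Q Q' : List Bool → Prop) {u v : List V} (h : ∀ b, Q b → ¬ Q' b) :
    pSum k n Q u v + pSum k n Q' u v = pSum k n (fun b => Q b ∨ Q' b) u v := by
  classical
  unfold pSum
  rw [← Finset.sum_add_distrib]
  refine Finset.sum_congr rfl fun b _ => ?_
  have := h (List.ofFn b)
  by_cases h1 : Q (List.ofFn b) <;> by_cases h2 : Q' (List.ofFn b) <;> simp_all

lemma last_true (l : List Bool) : (true :: l).getLast? ≠ some false ↔ l.getLast? ≠ some false := by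
  rw [List.getLast?_cons]
  rcases l.getLast? with _ | _ | _ <;> simp

lemma last_true' (l : List Bool) : (true :: l).getLast? = some true ↔ l.getLast? ≠ some false := by
  rw [List.getLast?_cons]
  rcases l.getLast? with _ | _ | _ <;> simp

lemma last_false (l : List Bool) (h : l ≠ []) :
    (false :: l).getLast? ≠ some false ↔ l.getLast? ≠ some false := by
  cases l with
  | nil => exact absurd rfl h
  | cons a l => rw [List.getLast?_cons_cons]

lemma aSum_nil_nil : aSum k ([] : List V) [] = 1 := pSum_zero k _ (by simp)

lemma aSum_cons_nil (x : V) (u : List V) : aSum k (x :: u) [] = 0 := by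
  refine pSum_false k fun b hb h0 h1 h => ?_
  have hne : b ≠ [] := by rintro rfl; simp at hb
  rw [List.getLast?_eq_some_getLast hne] at h
  have hm := List.getLast_mem hne
  cases hc : b.getLast hne
  · rw [hc] at h; simp at h
  · rw [hc] at hm
    have := List.count_pos_iff.2 hm
    simp only [List.length_nil] at h1; omega

lemma aSum_nil_cons (y : V) (v : List V) : aSum k [] (y :: v) = ltr k y * aSum k [] v := by
  have e : ([] : List V).length + (y :: v).length = (([] : List V).length + v.length) + 1 := rfl
  unfold aSum
  rw [e, pSum_succ_nil_left]
  congr 1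
  exact pSum_congr k fun b _ _ _ => last_true b

lemma aSum_cons_cons (x y : V) (u v : List V) :
    aSum k (x :: u) (y :: v) = ltr k x * aSum k u (y :: v) + ltr k y * aSum k (x :: u) v := by
  have e : (x :: u).length + (y :: v).length = (u.length + (y :: v).length) + 1 := by
    simp; omega
  have e' : (x :: u).length + v.length = u.length + (y :: v).length := by
    simp; omega
  unfold aSum
  rw [e, pSum_succ_cons, e']
  congr 2
  · refine pSum_congr k fun b hb _ _ => last_false b ?_
    rintro rfl; simp at hb
  · exact pSum_congr k fun b _ _ _ => last_true b

lemma seOp_cons (u : List V) (y : V) (v : List V) :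
    seOp k u (y :: v) = ltr k y * aSum k u v := by
  have e : u.length + (y :: v).length = (u.length + v.length) + 1 := rfl
  unfold seOp aSum
  rw [quadOp_eq_s2, e]
  cases u with
  | nil =>
    rw [pSum_succ_nil_left]
    congr 1
    refine pSum_congr k fun b _ _ _ => ?_
    rw [last_true']; simp
  | cons x u =>
    rw [pSum_succ_cons, pSum_false, mul_zero, zero_add]
    · congr 1
      refine pSum_congr k fun b _ _ _ => ?_
      rw [last_true']; simp
    · simp

lemma veeOp_eq (u v : List V) (hv : v ≠ []) : veeOp k u v = aSum k u v := by
  unfold veeOp seOp swOp aSum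
  rw [quadOp_eq_s2, quadOp_eq_s2, pSum_add]
  · refine pSum_congr k fun b hb _ _ => ?_
    have hp := List.length_pos_iff.2 hv
    cases b with
    | nil => simp at hb; omega
    | cons a b =>
      rw [List.getLast?_cons]
      cases a <;> rcases b.getLast? with _ | _ | _ <;> simp
  · rintro b ⟨h, _⟩ ⟨h', _⟩
    rw [h] at h'; simp at h'

lemma aSum_append (u v w : List V) :
    aSum k u (v ++ w) = ∑ i ∈ Finset.range (u.length + 1),
      aSum k (u.take i) v * aSum k (u.drop i) w := by
  induction v generalizing u with
  | nil =>
    rw [Finset.sum_range_succ']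
    rw [Finset.sum_eq_zero, zero_add]
    · simp [aSum_nil_nil]
    · intro i hi
      cases u with
      | nil => simp at hi
      | cons x u => simp [aSum_cons_nil]
  | cons y v ihv =>
    induction u with
    | nil =>
      have := ihv []
      simp at this
      simp [aSum_nil_cons, this, mul_assoc]
    | cons x u ihu =>
      rw [List.cons_append, aSum_cons_cons, ← List.cons_append, ihu, ihv (x :: u)]
      rw [List.length_cons, Finset.sum_range_succ' _ (u.length + 1),
        Finset.sum_range_succ' _ (u.length + 1)]
      simp only [List.take_succ_cons, List.drop_succ_cons, List.take_zero, List.drop_zero,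
        aSum_cons_cons, aSum_nil_cons, add_mul, Finset.sum_add_distrib, mul_add, Finset.mul_sum,
        mul_assoc, add_assoc]

theorem statement2 (u v w : List V) (hv : v ≠ []) (hw : w ≠ []) :
    seOp k u (v ++ w) =
      ∑ i ∈ Finset.range (u.length + 1),
        seOp k (u.take i) v * veeOp k (u.drop i) w := by
  obtain ⟨y, v, rfl⟩ := List.exists_cons_of_ne_nil hv
  rw [List.cons_append, seOp_cons, aSum_append, Finset.mul_sum]
  refine Finset.sum_congr rfl fun i _ => ?_
  rw [seOp_cons, veeOp_eq k _ _ hw, mul_assoc]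
end

section
/- Let u be an arbitrary word and v, w nonempty words over V. Then u ↖ (vw) = Σ_{u=u¹u²} (u¹ ↙ v)(u² ∧ w), where vw and the juxtaposition on the right denote concatenation and the sum runs over all cuts of u (with the empty-word conventions for the quadri-algebra operations). -/
open Finset MonoidAlgebra TensorProduct

variable (k : Type*) [CommRing k] {V : Type*}

/-- Bool words with `p` falses and `q` trues. -/
def blq : ℕ → ℕ → Finset (List Bool)
  | 0, 0 => {[]}
  | 0, q+1 => (blq 0 q).map ⟨List.cons true, List.cons_injective⟩
  | p+1, 0 => (blq p 0).map ⟨List.cons false, List.cons_injective⟩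
  | p+1, q+1 => (blq p (q+1)).map ⟨List.cons false, List.cons_injective⟩ ∪
      (blq (p+1) q).map ⟨List.cons true, List.cons_injective⟩
  termination_by p q => p + q

theorem mem_blq (L : List Bool) : ∀ p q, L ∈ blq p q ↔ L.count false = p ∧ L.count true = q := by
  induction L with
  | nil =>
    intro p q
    rcases p with _ | p <;> rcases q with _ | q <;> simp [blq]
  | cons x L ih =>
    intro p q
    rcases p with _ | p <;> rcases q with _ | q <;> cases x <;> simp [blq, ih]

def mergeq {V : Type*} : List Bool → List V → List V → List V
  | false :: L, a :: u, v => a :: mergeq L u v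
  | true :: L, u, b :: v => b :: mergeq L u v
  | _, _, _ => []

noncomputable def Fq (k : Type*) [CommRing k] {V : Type*} (P : List Bool → Prop) [DecidablePred P]
    (u v : List V) : MonoidAlgebra k (FreeMonoid V) :=
  ∑ L ∈ (blq u.length v.length).filter P, single (FreeMonoid.ofList (mergeq L u v)) (1:k)

section
variable {k : Type*} [CommRing k] {V : Type*} (P : List Bool → Prop) [DecidablePred P]

theorem Fq_nn : Fq k P ([] : List V) [] = if P [] then 1 else 0 := by
  simp only [Fq, List.length_nil, blq]
  split_ifs with h
  · rw [Finset.filter_true_of_mem (by simpa using h)]; simp [mergeq]; rfl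
  · rw [Finset.filter_false_of_mem (by simpa using h)]; simp

theorem single_cons (a : V) (l : List V) : (single (FreeMonoid.ofList (a :: l)) (1:k)) =
    single (FreeMonoid.of a) 1 * single (FreeMonoid.ofList l) 1 := by
  rw [MonoidAlgebra.single_mul_single, one_mul]; rfl

theorem Fq_nc (b : V) (v : List V) : Fq k P [] (b :: v) =
    single (FreeMonoid.of b) 1 * Fq k (fun L => P (true :: L)) [] v := by
  simp only [Fq, List.length_nil, List.length_cons, blq, Finset.sum_filter, Finset.sum_map,
    Finset.mul_sum, Function.Embedding.coeFn_mk]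
  refine Finset.sum_congr rfl fun L _ => ?_
  split_ifs <;> simp [mergeq]

theorem Fq_cn (a : V) (u : List V) : Fq k P (a :: u) [] =
    single (FreeMonoid.of a) 1 * Fq k (fun L => P (false :: L)) u [] := by
  simp only [Fq, List.length_nil, List.length_cons, blq, Finset.sum_filter, Finset.sum_map,
    Finset.mul_sum, Function.Embedding.coeFn_mk]
  refine Finset.sum_congr rfl fun L _ => ?_
  split_ifs <;> simp [mergeq]

theorem Fq_cc (a b : V) (u v : List V) : Fq k P (a :: u) (b :: v) =
    single (FreeMonoid.of a) 1 * Fq k (fun L => P (false :: L)) u (b :: v) +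
    single (FreeMonoid.of b) 1 * Fq k (fun L => P (true :: L)) (a :: u) v := by
  simp only [Fq, List.length_cons, blq, Finset.sum_filter]
  rw [Finset.sum_union]
  · simp only [Finset.sum_map, Finset.mul_sum, Function.Embedding.coeFn_mk]
    congr 1 <;>
    · refine Finset.sum_congr rfl fun L _ => ?_
      split_ifs <;> simp [mergeq]
  · rw [Finset.disjoint_left]
    intro L h1 h2
    simp only [Finset.mem_map, Function.Embedding.coeFn_mk] at h1 h2
    obtain ⟨x, _, rfl⟩ := h1
    obtain ⟨y, _, h⟩ := h2
    simp at h

theorem Fq_congr {P Q : List Bool → Prop} [DecidablePred P] [DecidablePred Q] (u v : List V)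
    (h : ∀ L, L.count false = u.length → L.count true = v.length → (P L ↔ Q L)) :
    Fq k P u v = Fq k Q u v := by
  unfold Fq
  congr 1
  refine Finset.filter_congr fun L hL => ?_
  rw [mem_blq] at hL
  exact h L hL.1 hL.2

theorem Fq_false (u v : List V) : Fq k (fun _ => False) u v = 0 := by
  simp [Fq]

end

noncomputable def Tq (k : Type*) [CommRing k] {V : Type*} (d lb : Bool)
    (u v : List V) : MonoidAlgebra k (FreeMonoid V) := Fq k (fun L => L.getLastD d = lb) u v

section
variable {k : Type*} [CommRing k] {V : Type*}

theorem Tq_nn (d lb : Bool) : Tq k d lb ([] : List V) [] = if d = lb then 1 else 0 := by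
  rw [Tq, Fq_nn]
  rfl

theorem Tq_nc (d lb : Bool) (b : V) (v : List V) : Tq k d lb [] (b :: v) =
    single (FreeMonoid.of b) 1 * Tq k true lb [] v := by
  simp only [Tq, Fq_nc, List.getLastD_cons]

theorem Tq_cn (d lb : Bool) (a : V) (u : List V) : Tq k d lb (a :: u) [] =
    single (FreeMonoid.of a) 1 * Tq k false lb u [] := by
  simp only [Tq, Fq_cn, List.getLastD_cons]

theorem Tq_cc (d lb : Bool) (a b : V) (u v : List V) : Tq k d lb (a :: u) (b :: v) =
    single (FreeMonoid.of a) 1 * Tq k false lb u (b :: v) +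
    single (FreeMonoid.of b) 1 * Tq k true lb (a :: u) v := by
  simp only [Tq, Fq_cc, List.getLastD_cons]

theorem Tq_indep (d d' lb : Bool) (u v : List V) (hv : v ≠ []) : Tq k d lb u v = Tq k d' lb u v := by
  refine Fq_congr _ _ fun L _ h => ?_
  cases L with
  | nil => simp at h; exact absurd (by simpa using h.symm) hv
  | cons x L => simp only [List.getLastD_cons]

theorem Tq_ft (u : List V) : Tq k false true u [] = 0 := by
  induction u with
  | nil => simp [Tq_nn]
  | cons a u ih => rw [Tq_cn, ih, mul_zero]

theorem Tq_tf (v : List V) : Tq k true false [] v = 0 := by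
  induction v with
  | nil => simp [Tq_nn]
  | cons a u ih => rw [Tq_nc, ih, mul_zero]

theorem Tq_main (w : List V) (hw : w ≠ []) (v : List V) : ∀ (u : List V), v ≠ [] → ∀ d1 d2 d3 : Bool,
    Tq k d1 false u (v ++ w) = ∑ i ∈ Finset.range (u.length + 1),
      Tq k d2 true (u.take i) v * Tq k d3 false (u.drop i) w := by
  induction v with
  | nil => intro _ h; exact absurd rfl h
  | cons b v ihv =>
    intro u
    induction u with
    | nil =>
      intro _ d1 d2 d3
      rw [Tq_indep d1 true _ _ _ (by simp), Tq_tf]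
      simp [Tq_indep d3 true _ _ _ hw, Tq_tf]
    | cons a u ihu =>
      intro h d1 d2 d3
      rw [Finset.sum_range_succ']
      simp only [List.length_cons, List.take_succ_cons, List.drop_succ_cons, List.take_zero,
        List.drop_zero, List.cons_append, Tq_cc, add_mul, Finset.sum_add_distrib]
      rw [← List.cons_append, ihu (by simp) false false d3]
      simp only [mul_assoc, ← Finset.mul_sum]
      rw [add_assoc]
      congr 1
      rw [Tq_nc, mul_assoc, ← mul_add]
      congr 1
      by_cases hv : v = []
      · subst hv
        simp only [Tq_cn, Tq_ft, List.nil_append, Tq_nn]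
        simp [Tq_indep true d3 _ _ w hw]
      · rw [ihv (a :: u) hv true true d3, Finset.sum_range_succ']
        simp
end

theorem count_take_ofFn_q : ∀ (n : ℕ) (f : Fin n → Bool) (b : Bool) (m : ℕ),
    ((List.ofFn f).take m).count b =
      (univ.filter (fun j : Fin n => j.1 < m ∧ f j = b)).card := by
  intro n
  induction n with
  | zero => intro f b m; simp
  | succ n ih =>
    intro f b m
    rw [Fin.card_filter_univ_succ']
    cases m with
    | zero => simp
    | succ m =>
      simp only [List.ofFn_succ, List.take_succ_cons, List.count_cons, ih]
      simp [add_comm]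

/-- Bool word of a permutation. -/
def wordq (p q : ℕ) (σ : Equiv.Perm (Fin (p + q))) : List Bool :=
  List.ofFn fun i => decide (p ≤ (σ.symm i : ℕ))

theorem wordq_length (p q : ℕ) (σ : Equiv.Perm (Fin (p + q))) : (wordq p q σ).length = p + q := by
  simp [wordq]

theorem wordq_count_false (p q : ℕ) (σ : Equiv.Perm (Fin (p + q))) :
    (wordq p q σ).count false = p := by
  have h := count_take_ofFn_q (p+q) (fun i => decide (p ≤ (σ.symm i : ℕ))) false (p+q)
  rw [List.take_of_length_le (by simp)] at h
  unfold wordq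
  rw [h]
  have : (univ.filter (fun j : Fin (p+q) => j.1 < p + q ∧ decide (p ≤ (σ.symm j : ℕ)) = false))
      = ((univ : Finset (Fin p)).map (Fin.castAddEmb q)).map σ.toEmbedding := by
    ext j
    simp only [mem_filter, mem_univ, true_and, mem_map, decide_eq_false_iff_not, not_le,
      Equiv.coe_toEmbedding]
    constructor
    · rintro ⟨_, h⟩
      exact ⟨σ.symm j, ⟨⟨_, h⟩, rfl⟩, by simp⟩
    · rintro ⟨_, ⟨a, rfl⟩, rfl⟩
      simp
  rw [this]; simp

theorem wordq_count_true (p q : ℕ) (σ : Equiv.Perm (Fin (p + q))) :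
    (wordq p q σ).count true = q := by
  have h1 := wordq_count_false p q σ
  have h2 := wordq_length p q σ
  have h3 := List.count_false_add_count_true (wordq p q σ)
  omega

theorem wordq_false {p q : ℕ} {σ : Equiv.Perm (Fin (p + q))} (hσ : IsSh p q σ) (i : Fin (p+q))
    (hi : (σ.symm i : ℕ) < p) : ((wordq p q σ).take i).count false = σ.symm i := by
  unfold wordq
  rw [count_take_ofFn_q]
  have : (univ.filter (fun j : Fin (p+q) => j.1 < i.1 ∧ decide (p ≤ (σ.symm j : ℕ)) = false))
      = (Finset.Iio (σ.symm i)).map σ.toEmbedding := by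
    ext j
    obtain ⟨j, rfl⟩ := σ.surjective j
    obtain ⟨i, rfl⟩ := σ.surjective i
    simp only [Equiv.symm_apply_apply] at hi ⊢
    simp only [mem_filter, mem_univ, true_and, decide_eq_false_iff_not, not_le,
      Equiv.symm_apply_apply]
    rw [← Equiv.coe_toEmbedding, Finset.mem_map']
    simp only [Equiv.coe_toEmbedding, Finset.mem_Iio, Fin.val_fin_lt]
    constructor
    · rintro ⟨h1, h2⟩
      by_contra h
      rcases (not_lt.1 h).eq_or_lt with h | h
      · subst h; exact lt_irrefl _ h1
      · exact lt_asymm h1 (hσ.1 i j h h2)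
    · intro h
      exact ⟨hσ.1 j i h hi, lt_trans h hi⟩
  rw [this]; simp

theorem wordq_true {p q : ℕ} {σ : Equiv.Perm (Fin (p + q))} (hσ : IsSh p q σ) (i : Fin (p+q))
    (hi : p ≤ (σ.symm i : ℕ)) : p + ((wordq p q σ).take i).count true = σ.symm i := by
  unfold wordq
  rw [count_take_ofFn_q]
  have hq : p < p + q := lt_of_le_of_lt hi (σ.symm i).2
  have : (univ.filter (fun j : Fin (p+q) => j.1 < i.1 ∧ decide (p ≤ (σ.symm j : ℕ)) = true))
      = (Finset.Ico (⟨p, hq⟩ : Fin (p+q)) (σ.symm i)).map σ.toEmbedding := by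
    ext j
    obtain ⟨j, rfl⟩ := σ.surjective j
    obtain ⟨i, rfl⟩ := σ.surjective i
    simp only [Equiv.symm_apply_apply] at hi ⊢
    simp only [mem_filter, mem_univ, true_and, decide_eq_true_eq,
      Equiv.symm_apply_apply]
    rw [← Equiv.coe_toEmbedding, Finset.mem_map']
    simp only [Equiv.coe_toEmbedding, Finset.mem_Ico, Fin.val_fin_lt, Fin.le_def]
    constructor
    · rintro ⟨h1, h2⟩
      refine ⟨h2, ?_⟩
      by_contra h
      rcases (not_lt.1 h).eq_or_lt with h | h
      · subst h; exact lt_irrefl _ h1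
      · exact lt_asymm h1 (hσ.2 i j hi h)
    · rintro ⟨h1, h2⟩
      exact ⟨hσ.2 j i h1 h2, h1⟩
  rw [this]; simp; omega

theorem wordq_inj {p q : ℕ} {σ τ : Equiv.Perm (Fin (p + q))} (hσ : IsSh p q σ) (hτ : IsSh p q τ)
    (h : wordq p q σ = wordq p q τ) : σ = τ := by
  have : σ.symm = τ.symm := by
    ext i
    have h0 : (p ≤ (σ.symm i : ℕ)) ↔ (p ≤ (τ.symm i : ℕ)) := by
      have := List.ofFn_injective h
      simpa using congrFun this i
    by_cases hi : p ≤ (σ.symm i : ℕ)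
    · rw [← wordq_true hσ i hi, ← wordq_true hτ i (h0.1 hi), h]
    · rw [← wordq_false hσ i (by omega), ← wordq_false hτ i (by omega), h]
  rw [← Equiv.symm_symm σ, this, Equiv.symm_symm]

theorem count_take_lt_q (L : List Bool) (b : Bool) (i j : ℕ) (hij : i < j) (hi : L[i]? = some b) :
    (L.take i).count b < (L.take j).count b := by
  have h1 : (L.take (i+1)).count b = (L.take i).count b + 1 := by
    rw [List.take_add_one, hi]; simp
  have h2 : (L.take (i+1)).count b ≤ (L.take j).count b :=
    (List.take_sublist_take_left (by omega)).count_le b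
  omega

theorem wordq_surj {p q : ℕ} (L : List Bool) (h0 : L.count false = p) (h1 : L.count true = q) :
    ∃ σ, IsSh p q σ ∧ wordq p q σ = L := by
  have hlen : L.length = p + q := by
    rw [← List.count_false_add_count_true L, h0, h1]
  have hget : ∀ i : Fin (p+q), L[i.1]? = some (L[i.1]'(by omega)) := fun i => by simp
  have bd : ∀ (i : Fin (p+q)) (b : Bool), L[i.1]'(by omega) = b →
      (L.take i.1).count b < L.count b := by
    intro i b hb
    have := count_take_lt_q L b i.1 L.length (by omega) (by rw [hget, hb])
    simpa using this
  let g : Fin (p+q) → Fin (p+q) := fun i =>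
    if hb : L[i.1]'(by omega) = true then ⟨p + (L.take i.1).count true, by
        have := bd i true hb; omega⟩
    else ⟨(L.take i.1).count false, by
        have := bd i false (by simpa using hb); omega⟩
  have gt : ∀ i, L[i.1]'(by omega) = true → (g i).1 = p + (L.take i.1).count true := by
    intro i hb; simp only [g, dif_pos hb]
  have gf : ∀ i, L[i.1]'(by omega) = false → (g i).1 = (L.take i.1).count false := by
    intro i hb
    have hb' : ¬ (L[i.1]'(by omega) = true) := by simp [hb]
    simp only [g, dif_neg hb']
  have gf' : ∀ i, L[i.1]'(by omega) = false → (g i).1 < p := by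
    intro i hb; rw [gf i hb]; have := bd i false hb; omega
  have gt' : ∀ i, L[i.1]'(by omega) = true → p ≤ (g i).1 := by
    intro i hb; rw [gt i hb]; omega
  have tI : ∀ i, p ≤ (g i).1 → L[i.1]'(by omega) = true := by
    intro i h
    by_contra hb
    have := gf' i (by simpa using hb); omega
  have fI : ∀ i, (g i).1 < p → L[i.1]'(by omega) = false := by
    intro i h
    by_contra hb
    have := gt' i (by simpa using hb); omega
  have mf : ∀ i j : Fin (p+q), i < j → (g i).1 < p → (g j).1 < p → g i < g j := by
    intro i j hij hi hj
    rw [Fin.lt_def, gf i (fI i hi), gf j (fI j hj)]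
    exact count_take_lt_q L false i j hij (by rw [hget, fI i hi])
  have mt : ∀ i j : Fin (p+q), i < j → p ≤ (g i).1 → p ≤ (g j).1 → g i < g j := by
    intro i j hij hi hj
    rw [Fin.lt_def, gt i (tI i hi), gt j (tI j hj)]
    have := count_take_lt_q L true i j hij (by rw [hget, tI i hi])
    omega
  have ne : ∀ i j : Fin (p+q), i < j → g i ≠ g j := by
    intro i j hij h
    by_cases hi : (g i).1 < p
    · exact absurd h (mf i j hij hi (h ▸ hi)).ne
    · exact absurd h (mt i j hij (by omega) (by rw [← h]; omega)).ne
  have inj : Function.Injective g := by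
    intro i j h
    rcases lt_trichotomy i j with h' | h' | h'
    · exact absurd h (ne _ _ h')
    · exact h'
    · exact absurd h.symm (ne _ _ h')
  let e : Equiv.Perm (Fin (p+q)) := Equiv.ofBijective g (Finite.injective_iff_bijective.1 inj)
  have he : ∀ i, e i = g i := fun i => rfl
  refine ⟨e.symm, ⟨?_, ?_⟩, ?_⟩
  · intro i j hij hj
    obtain ⟨i, rfl⟩ := e.surjective i
    obtain ⟨j, rfl⟩ := e.surjective j
    rw [Equiv.symm_apply_apply, Equiv.symm_apply_apply]
    rw [he] at hij hj
    rw [he] at hij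
    by_contra h
    rcases (not_lt.1 h).eq_or_lt with h | h
    · subst h; omega
    · have := mf j i h (by omega) (by omega)
      rw [Fin.lt_def] at this; omega
  · intro i j hi hij
    obtain ⟨i, rfl⟩ := e.surjective i
    obtain ⟨j, rfl⟩ := e.surjective j
    rw [Equiv.symm_apply_apply, Equiv.symm_apply_apply]
    rw [he] at hij hi
    rw [he] at hij
    by_contra h
    rcases (not_lt.1 h).eq_or_lt with h | h
    · subst h; omega
    · have := mt j i h (by omega) (by omega)
      rw [Fin.lt_def] at this; omega
  · refine List.ext_getElem (by rw [wordq_length, hlen]) ?_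
    intro i hi hi'
    simp only [wordq, List.getElem_ofFn, Equiv.symm_symm, he]
    by_cases hb : L[i]'(by omega) = true
    · rw [hb]; simpa using gt' ⟨i, by omega⟩ hb
    · have hb : L[i]'(by omega) = false := by simpa using hb
      rw [hb]; simpa using gf' ⟨i, by omega⟩ hb

theorem mergeq_get {V : Type*} (L : List Bool) : ∀ (u v : List V),
    L.count false = u.length → L.count true = v.length → ∀ i : ℕ,
    (mergeq L u v)[i]? = L[i]?.bind fun b =>
      if b then v[(L.take i).count true]? else u[(L.take i).count false]? := by
  induction L with
  | nil => intro u v _ _ i; simp [mergeq]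
  | cons x L ih =>
    intro u v hu hv i
    cases x with
    | false =>
      cases u with
      | nil => simp at hu
      | cons a u =>
        cases i with
        | zero => simp [mergeq]
        | succ i =>
          simp only [mergeq, List.getElem?_cons_succ, List.take_succ_cons]
          rw [ih u v (by simpa using hu) (by simpa using hv)]
          simp
    | true =>
      cases v with
      | nil => simp at hv
      | cons a v =>
        cases i with
        | zero => simp [mergeq]
        | succ i =>
          simp only [mergeq, List.getElem?_cons_succ, List.take_succ_cons]
          rw [ih u v (by simpa using hu) (by simpa using hv)]
          simp

theorem shWord_eq_mergeq {V : Type*} (u v : List V) (σ : Equiv.Perm (Fin (u.length + v.length)))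
    (hσ : IsSh u.length v.length σ) :
    shWord u v σ = FreeMonoid.ofList (mergeq (wordq u.length v.length σ) u v) := by
  unfold shWord
  congr 1
  refine List.ext_getElem? fun i => ?_
  rw [mergeq_get _ _ _ (wordq_count_false _ _ _) (wordq_count_true _ _ _)]
  by_cases hi : i < u.length + v.length
  · have e1 : (wordq u.length v.length σ)[i]? =
        some (decide (u.length ≤ (σ.symm ⟨i, hi⟩ : ℕ))) := by
      simp [wordq, hi]
    rw [e1, Option.bind_some]
    have e2 : (List.ofFn fun i => (u ++ v).get
        (Fin.cast (List.length_append (as := u) (bs := v)).symm (σ.symm i)))[i]?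
        = (u ++ v)[(σ.symm ⟨i, hi⟩ : ℕ)]? := by
      simp [hi]
    rw [e2]
    by_cases hb : u.length ≤ (σ.symm ⟨i, hi⟩ : ℕ)
    · have := wordq_true hσ ⟨i, hi⟩ hb
      rw [List.getElem?_append_right hb, ← this, Nat.add_sub_cancel_left, this]
      simp only [hb, decide_true, if_true]
    · have := wordq_false hσ ⟨i, hi⟩ (by omega)
      rw [List.getElem?_append_left (by omega), ← this]
      simp [hb, this]
  · rw [List.getElem?_eq_none (by simpa using hi), List.getElem?_eq_none (by
      rw [wordq_length]; omega)]
    rfl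

theorem quadOp_eq_Fq (k : Type*) [CommRing k] {V : Type*} (fb lb : Bool) (u v : List V) :
    quadOp k fb lb u v = Fq k (fun L => L.head? = some fb ∧ L.getLast? = some lb) u v := by
  unfold quadOp Fq
  have pc : ∀ (p i : ℕ) (b : Bool), posCond p b i ↔ decide (p ≤ i) = b := by
    intro p i b; cases b <;> simp [posCond]
  have key : ∀ σ : Equiv.Perm (Fin (u.length + v.length)),
      (∃ h : 0 < u.length + v.length,
        posCond u.length fb (σ.symm ⟨0, h⟩) ∧
        posCond u.length lb (σ.symm ⟨u.length + v.length - 1, Nat.sub_lt h Nat.one_pos⟩)) ↔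
      ((wordq u.length v.length σ).head? = some fb ∧
        (wordq u.length v.length σ).getLast? = some lb) := by
    intro σ
    rw [List.getLast?_eq_getElem?, List.head?_eq_getElem?, wordq_length]
    by_cases h : 0 < u.length + v.length
    · have h' : u.length + v.length - 1 < u.length + v.length := by omega
      simp only [pc, wordq, List.getElem?_ofFn, h, h', dif_pos, Option.some.injEq, exists_true_left]
    · have h1 : wordq u.length v.length σ = [] := by
        rw [← List.length_eq_zero_iff, wordq_length]; omega
      simp [h1]; omega
  refine Finset.sum_bij (fun σ _ => wordq u.length v.length σ) ?_ ?_ ?_ ?_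
  · intro σ hσ
    rw [mem_filter] at hσ ⊢
    rw [mem_blq]
    exact ⟨⟨wordq_count_false _ _ _, wordq_count_true _ _ _⟩, (key σ).1 hσ.2.2⟩
  · intro σ hσ τ hτ h
    rw [mem_filter] at hσ hτ
    exact wordq_inj hσ.2.1 hτ.2.1 h
  · intro L hL
    rw [mem_filter, mem_blq] at hL
    obtain ⟨σ, h1, h2⟩ := wordq_surj L hL.1.1 hL.1.2
    refine ⟨σ, ?_, h2⟩
    rw [mem_filter]
    exact ⟨mem_univ _, h1, (key σ).2 (h2 ▸ hL.2)⟩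
  · intro σ hσ
    rw [mem_filter] at hσ
    rw [shWord_eq_mergeq u v σ hσ.2.1]

theorem quadOp_nil_q (k : Type*) [CommRing k] {V : Type*} (lb : Bool) (v : List V) (hv : v ≠ []) :
    quadOp k false lb [] v = 0 := by
  obtain ⟨b, v, rfl⟩ := List.exists_cons_of_ne_nil hv
  rw [quadOp_eq_Fq, Fq_nc, Fq_congr (Q := fun _ => False), Fq_false, mul_zero]
  simp

theorem quadOp_cons_q (k : Type*) [CommRing k] {V : Type*} (lb : Bool) (a : V) (u v : List V)
    (hv : v ≠ []) :
    quadOp k false lb (a :: u) v = single (FreeMonoid.of a) 1 * Tq k false lb u v := by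
  obtain ⟨b, v, rfl⟩ := List.exists_cons_of_ne_nil hv
  rw [quadOp_eq_Fq, Fq_cc, Fq_congr (P := fun L => (true :: L).head? = _ ∧ _)
    (Q := fun _ => False), Fq_false, mul_zero, add_zero]
  · congr 1
    refine Fq_congr _ _ fun L _ _ => ?_
    simp [List.getLast?_cons, List.getLastD_eq_getLast?]
  · simp

theorem wedgeOp_eq_Tq (k : Type*) [CommRing k] {V : Type*} (u v : List V) (hv : v ≠ []) :
    wedgeOp k u v = Tq k false false u v := by
  unfold wedgeOp neOp nwOp Tq
  rw [quadOp_eq_Fq, quadOp_eq_Fq]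
  simp only [Fq, Finset.sum_filter]
  rw [← Finset.sum_add_distrib]
  refine Finset.sum_congr rfl fun L hL => ?_
  rw [mem_blq] at hL
  cases L with
  | nil =>
    have := hL.2
    simp at this
    exact absurd (by simpa using this.symm) hv
  | cons x L =>
    cases x <;> simp [List.getLast?_cons, List.getLastD_eq_getLast?]

theorem statement6 (u v w : List V) (hv : v ≠ []) (hw : w ≠ []) :
    nwOp k u (v ++ w) =
      ∑ i ∈ Finset.range (u.length + 1),
        swOp k (u.take i) v * wedgeOp k (u.drop i) w := by
  unfold nwOp swOp
  cases u with
  | nil => simp [quadOp_nil_q k _ _ hv, quadOp_nil_q k _ (v ++ w) (by simp [hv])]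
  | cons a u =>
    rw [Finset.sum_range_succ', quadOp_cons_q k _ _ _ _ (by simp [hv]),
      Tq_main w hw v u hv false false false]
    simp [quadOp_nil_q k _ _ hv, quadOp_cons_q k _ _ _ _ hv, wedgeOp_eq_Tq k _ _ hw,
      Finset.mul_sum, mul_assoc]
end

section
/- Let u be an arbitrary word and v, w nonempty words over V. Then u ⧢ (vw) = Σ_{u=u¹u²} (u¹ ∨ v)(u² ⧢ w) and u ⧢ (vw) = Σ_{u=u¹u²} (u¹ ⧢ v)(u² ≻ w), where vw and the juxtapositions on the right denote concatenation and the sums run over all cuts of u (with the empty-word conventions for the operations, and 1⧢a = a⧢1 = a). -/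
open Finset MonoidAlgebra TensorProduct

variable (k : Type*) [CommRing k] {V : Type*}

namespace Quadri

/-- Merge two lists following a pattern (`true` : take from the second list). -/
def merge {α : Type*} : List α → List α → List Bool → List α
  | a :: x, y, false :: l => a :: merge x y l
  | x, b :: y, true :: l => b :: merge x y l
  | _, _, _ => []

theorem merge_false {α : Type*} (a : α) (x y l) :
    merge (a :: x) y (false :: l) = a :: merge x y l := by
  simp [merge]

theorem merge_true {α : Type*} (b : α) (x y l) :
    merge x (b :: y) (true :: l) = b :: merge x y l := by
  cases x <;> simp [merge]

/-- Patterns with `p` times `false` and `q` times `true`. -/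
def B : ℕ → ℕ → Finset (List Bool)
  | 0, q => {List.replicate q true}
  | p + 1, 0 => {List.replicate (p + 1) false}
  | p + 1, q + 1 => (B p (q + 1)).image (List.cons false) ∪ (B (p + 1) q).image (List.cons true)
termination_by p q => p + q

theorem mem_B (l : List Bool) : ∀ p q, l ∈ B p q ↔ l.count false = p ∧ l.count true = q := by
  induction l with
  | nil =>
    intro p q
    rcases p with _ | p <;> rcases q with _ | q <;> simp [B, List.replicate_succ]
  | cons c l ih =>
    intro p q
    rcases p with _ | p
    · rcases q with _ | q
      · cases c <;> simp [B]
      · have := ih 0 q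
        cases c <;> simp [B, List.replicate_succ] at this ⊢
        exact this
    · rcases q with _ | q
      · have := ih p 0
        cases c
        · rcases p with _ | p
          · simpa [B, List.replicate_succ] using this
          · simpa [B, List.replicate_succ] using this
        · simp [B, List.replicate_succ]
      · cases c <;> simp [B, ih]

theorem sum_B_succ {M : Type*} [AddCommMonoid M] (p q : ℕ) (G : List Bool → M) :
    ∑ l ∈ B (p + 1) (q + 1), G l =
      ∑ l ∈ B p (q + 1), G (false :: l) + ∑ l ∈ B (p + 1) q, G (true :: l) := by
  rw [B, Finset.sum_union, Finset.sum_image, Finset.sum_image]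
  · intro a _ b _ h; simpa using h
  · intro a _ b _ h; simpa using h
  · rw [Finset.disjoint_left]
    intro x hx hy
    simp only [Finset.mem_image] at hx hy
    obtain ⟨_, _, rfl⟩ := hx
    obtain ⟨_, _, h⟩ := hy
    simp at h

theorem merge_filter {α : Type*} (P : α → Bool) (L : List α) :
    merge (L.filter (fun x => !P x)) (L.filter P) (L.map P) = L := by
  induction L with
  | nil => simp [merge]
  | cons a L ih =>
    cases h : P a
    · simp [h, merge_false, ih]
    · simp [h, merge_true, ih]

theorem map_merge {α β : Type*} (f : α → β) (l : List Bool) : ∀ x y : List α,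
    (merge x y l).map f = merge (x.map f) (y.map f) l := by
  induction l with
  | nil => intro x y; cases x <;> cases y <;> simp [merge]
  | cons c l ih =>
    intro x y
    cases c
    · cases x
      · cases y <;> simp [merge]
      · simp [merge_false, ih]
    · cases y
      · cases x <;> simp [merge]
      · simp [merge_true, ih]

theorem merge_perm {α : Type*} (l : List Bool) : ∀ x y : List α,
    l.count false = x.length → l.count true = y.length → (merge x y l).Perm (x ++ y) := by
  induction l with
  | nil =>
    intro x y h1 h2
    have hx : x = [] := by simpa using h1.symm
    have hy : y = [] := by simpa using h2.symm
    subst hx hy; simp [merge]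
  | cons c l ih =>
    intro x y h1 h2
    cases c
    · rcases x with _ | ⟨a, x⟩
      · simp at h1
      · simp at h1 h2
        rw [merge_false]
        exact (ih x y h1 h2).cons a
    · rcases y with _ | ⟨b, y⟩
      · simp at h2
      · simp at h1 h2
        rw [merge_true]
        exact ((ih x y h1 h2).cons b).trans List.perm_middle.symm

theorem merge_map {α : Type*} (P : α → Bool) (l : List Bool) : ∀ x y : List α,
    l.count false = x.length → l.count true = y.length →
    (∀ a ∈ x, P a = false) → (∀ a ∈ y, P a = true) → (merge x y l).map P = l := by
  induction l with
  | nil =>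
    intro x y h1 h2 _ _
    have hx : x = [] := by simpa using h1.symm
    have hy : y = [] := by simpa using h2.symm
    subst hx hy; simp [merge]
  | cons c l ih =>
    intro x y h1 h2 h3 h4
    cases c
    · rcases x with _ | ⟨a, x⟩
      · simp at h1
      · simp at h1 h2 h3
        rw [merge_false, List.map_cons, ih x y h1 h2 h3.2 h4, h3.1]
    · rcases y with _ | ⟨b, y⟩
      · simp at h2
      · simp at h1 h2 h4
        rw [merge_true, List.map_cons, ih x y h1 h2 h3 h4.2, h4.1]

theorem merge_pairwise {α : Type*} (P : α → Bool) (R : α → α → Prop) (l : List Bool) :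
    ∀ x y : List α,
    l.count false = x.length → l.count true = y.length →
    (∀ a ∈ x, P a = false) → (∀ a ∈ y, P a = true) → x.Pairwise R → y.Pairwise R →
    (merge x y l).Pairwise (fun a b => P a = P b → R a b) := by
  induction l with
  | nil =>
    intro x y h1 h2 _ _ _ _
    have hx : x = [] := by simpa using h1.symm
    have hy : y = [] := by simpa using h2.symm
    subst hx hy; simp [merge]
  | cons c l ih =>
    intro x y h1 h2 h3 h4 h5 h6
    cases c
    · rcases x with _ | ⟨a, x⟩
      · simp at h1
      · simp at h1 h2 h3
        rw [List.pairwise_cons] at h5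
        rw [merge_false, List.pairwise_cons]
        refine ⟨?_, ih x y h1 h2 h3.2 h4 h5.2 h6⟩
        intro b hb hP
        have hb' := (merge_perm l x y h1 h2).mem_iff.1 hb
        rcases List.mem_append.1 hb' with hb' | hb'
        · exact h5.1 b hb'
        · rw [h3.1, h4 b hb'] at hP; simp at hP
    · rcases y with _ | ⟨a, y⟩
      · simp at h2
      · simp at h1 h2 h4
        rw [List.pairwise_cons] at h6
        rw [merge_true, List.pairwise_cons]
        refine ⟨?_, ih x y h1 h2 h3 h4.2 h5 h6.2⟩
        intro b hb hP
        have hb' := (merge_perm l x y h1 h2).mem_iff.1 hb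
        rcases List.mem_append.1 hb' with hb' | hb'
        · rw [h4.1, h3 b hb'] at hP; simp at hP
        · exact h6.1 b hb'

/-- Does the index come from the second word? -/
def Q (p q : ℕ) (x : Fin (p + q)) : Bool := decide (p ≤ (x : ℕ))

/-- Pattern of a permutation. -/
def pat (p q : ℕ) (σ : Equiv.Perm (Fin (p + q))) : List Bool :=
  (List.ofFn σ.symm).map (Q p q)

theorem isSh_iff (p q : ℕ) (σ : Equiv.Perm (Fin (p + q))) :
    IsSh p q σ ↔ (List.ofFn σ.symm).Pairwise (fun a b => Q p q a = Q p q b → a < b) := by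
  rw [List.pairwise_ofFn]
  constructor
  · rintro ⟨h1, h2⟩ i j hij hQ
    by_contra hcon
    have hne : σ.symm i ≠ σ.symm j := fun h => hij.ne (σ.symm.injective h)
    have hlt : σ.symm j < σ.symm i := lt_of_le_of_ne (not_lt.1 hcon) hne.symm
    by_cases hp : p ≤ (σ.symm j : ℕ)
    · have := h2 _ _ hp hlt
      simp at this
      exact absurd hij (not_lt.2 this.le)
    · have hp' : ¬ p ≤ (σ.symm i : ℕ) := by
        simpa [Q, hp] using hQ
      have := h1 _ _ hlt (not_le.1 hp')
      simp at this
      exact absurd hij (not_lt.2 this.le)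
  · intro h
    have key : ∀ i j : Fin (p + q), i < j → Q p q i = Q p q j → σ i < σ j := by
      intro i j hij hQ
      by_contra hcon
      have hne : σ i ≠ σ j := fun h => hij.ne (σ.injective h)
      have hlt : σ j < σ i := lt_of_le_of_ne (not_lt.1 hcon) hne.symm
      have := h hlt (by simpa using hQ.symm)
      simp at this
      exact absurd hij (not_lt.2 this.le)
    constructor
    · intro i j hij hj
      apply key i j hij
      simp only [Q]
      rw [decide_eq_decide]
      omega
    · intro i j hi hij
      apply key i j hij
      simp only [Q]
      rw [decide_eq_decide]
      omega

/-- Indices of the first word. -/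
def idxA (p q : ℕ) : List (Fin (p + q)) := (List.finRange p).map (Fin.castAdd q)
/-- Indices of the second word. -/
def idxB (p q : ℕ) : List (Fin (p + q)) := (List.finRange q).map (Fin.natAdd p)

theorem idxA_Q (p q : ℕ) : ∀ a ∈ idxA p q, Q p q a = false := by
  intro a ha
  simp only [idxA, List.mem_map] at ha
  obtain ⟨i, _, rfl⟩ := ha
  simp [Q]

theorem idxB_Q (p q : ℕ) : ∀ a ∈ idxB p q, Q p q a = true := by
  intro a ha
  simp only [idxB, List.mem_map] at ha
  obtain ⟨i, _, rfl⟩ := ha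
  simp [Q]

theorem idxA_sorted (p q : ℕ) : (idxA p q).Pairwise (· < ·) := by
  rw [idxA, List.pairwise_map]
  exact (List.pairwise_lt_finRange p).imp (by intro a b h; exact h)

theorem idxB_sorted (p q : ℕ) : (idxB p q).Pairwise (· < ·) := by
  rw [idxB, List.pairwise_map]
  exact (List.pairwise_lt_finRange q).imp (by intro a b h; simpa using h)

theorem mem_idxA (p q : ℕ) (a : Fin (p + q)) : a ∈ idxA p q ↔ Q p q a = false := by
  refine ⟨idxA_Q p q a, ?_⟩
  intro h
  simp [Q] at h
  simp only [idxA, List.mem_map]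
  exact ⟨⟨a, h⟩, List.mem_finRange _, by ext; simp⟩

theorem mem_idxB (p q : ℕ) (a : Fin (p + q)) : a ∈ idxB p q ↔ Q p q a = true := by
  refine ⟨idxB_Q p q a, ?_⟩
  intro h
  simp [Q] at h
  simp only [idxB, List.mem_map]
  exact ⟨⟨a - p, by omega⟩, List.mem_finRange _, by ext; simp; omega⟩

theorem sorted_ext {n : ℕ} {x y : List (Fin n)} (hx : x.Pairwise (· < ·))
    (hy : y.Pairwise (· < ·)) (h : ∀ a, a ∈ x ↔ a ∈ y) : x = y := by
  have hp : x.Perm y := (List.perm_ext_iff_of_nodup (hx.imp (fun h => h.ne))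
    (hy.imp (fun h => h.ne))).2 h
  exact hp.eq_of_pairwise (fun a b _ _ h1 h2 => absurd h1 (not_lt.2 h2.le)) hx hy

theorem filterA (p q : ℕ) (σ : Equiv.Perm (Fin (p + q))) (h : IsSh p q σ) :
    (List.ofFn σ.symm).filter (fun x => !Q p q x) = idxA p q := by
  rw [isSh_iff] at h
  apply sorted_ext _ (idxA_sorted p q)
  · intro a
    rw [mem_idxA, List.mem_filter, List.mem_ofFn]
    simp only [Bool.not_eq_true', and_iff_right_iff_imp]
    intro _
    exact ⟨σ a, by simp⟩
  · rw [List.pairwise_filter]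
    refine h.imp ?_
    intro a b hab h1 h2
    apply hab
    simp at h1 h2
    rw [h1, h2]

theorem filterB (p q : ℕ) (σ : Equiv.Perm (Fin (p + q))) (h : IsSh p q σ) :
    (List.ofFn σ.symm).filter (Q p q) = idxB p q := by
  rw [isSh_iff] at h
  apply sorted_ext _ (idxB_sorted p q)
  · intro a
    rw [mem_idxB, List.mem_filter, List.mem_ofFn]
    simp only [and_iff_right_iff_imp]
    intro _
    exact ⟨σ a, by simp⟩
  · rw [List.pairwise_filter]
    refine h.imp ?_
    intro a b hab h1 h2
    apply hab
    rw [h1, h2]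

theorem ofFn_eq_merge (p q : ℕ) (σ : Equiv.Perm (Fin (p + q))) (h : IsSh p q σ) :
    List.ofFn σ.symm = merge (idxA p q) (idxB p q) (pat p q σ) := by
  rw [← filterA p q σ h, ← filterB p q σ h, pat, merge_filter]

theorem pat_mem (p q : ℕ) (σ : Equiv.Perm (Fin (p + q))) (h : IsSh p q σ) :
    pat p q σ ∈ B p q := by
  rw [mem_B]
  constructor
  · have := congrArg List.length (filterA p q σ h)
    rw [← List.countP_eq_length_filter] at this
    rw [pat, List.count, List.countP_map]
    simp only [idxA, List.length_map, List.length_finRange] at this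
    refine Eq.trans ?_ this
    congr 1
    funext x
    simp
  · have := congrArg List.length (filterB p q σ h)
    rw [← List.countP_eq_length_filter] at this
    rw [pat, List.count, List.countP_map]
    simp only [idxB, List.length_map, List.length_finRange] at this
    refine Eq.trans ?_ this
    congr 1
    funext x
    simp

theorem pat_inj (p q : ℕ) (σ τ : Equiv.Perm (Fin (p + q))) (h : IsSh p q σ) (h' : IsSh p q τ)
    (e : pat p q σ = pat p q τ) : σ = τ := by
  have h1 := ofFn_eq_merge p q σ h
  rw [e, ← ofFn_eq_merge p q τ h'] at h1
  have h2 := List.ofFn_injective h1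
  have h3 : σ.symm = τ.symm := DFunLike.coe_injective h2
  exact Equiv.symm_bijective.injective h3

theorem pat_surj (p q : ℕ) (l : List Bool) (hl : l ∈ B p q) :
    ∃ σ, IsSh p q σ ∧ pat p q σ = l := by
  rw [mem_B] at hl
  have hA : l.count false = (idxA p q).length := by simp [idxA, hl.1]
  have hB : l.count true = (idxB p q).length := by simp [idxB, hl.2]
  have hperm := merge_perm l _ _ hA hB
  have hlen : (merge (idxA p q) (idxB p q) l).length = p + q := by
    rw [hperm.length_eq]; simp [idxA, idxB]
  have hnd : (merge (idxA p q) (idxB p q) l).Nodup := by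
    rw [hperm.nodup_iff, List.nodup_append]
    refine ⟨(idxA_sorted p q).imp (fun h => h.ne), (idxB_sorted p q).imp (fun h => h.ne), ?_⟩
    rintro a ha b hb rfl
    have := idxA_Q p q a ha
    rw [idxB_Q p q a hb] at this
    simp at this
  have hpw := merge_pairwise (Q p q) (· < ·) l _ _ hA hB (idxA_Q p q) (idxB_Q p q)
    (idxA_sorted p q) (idxB_sorted p q)
  have hmap := merge_map (Q p q) l _ _ hA hB (idxA_Q p q) (idxB_Q p q)
  generalize merge (idxA p q) (idxB p q) l = L at *
  let f : Fin (p + q) → Fin (p + q) := fun i => L.get (Fin.cast hlen.symm i)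
  have hf : Function.Injective f := by
    intro i j hij
    have := List.nodup_iff_injective_get.1 hnd hij
    simpa using this
  let e : Equiv.Perm (Fin (p + q)) := Equiv.ofBijective f (Finite.injective_iff_bijective.1 hf)
  have he : List.ofFn e.symm.symm = L := by
    apply List.ext_get
    · simp [hlen]
    · intro n h1 h2
      simp [e, f]
  refine ⟨e.symm, ?_, ?_⟩
  · rw [isSh_iff, he]; exact hpw
  · rw [pat, he, hmap]

theorem sum_sh {M : Type*} [AddCommMonoid M] (p q : ℕ) (G : List Bool → M) :
    ∑ σ ∈ univ.filter (IsSh p q), G (pat p q σ) = ∑ l ∈ B p q, G l := by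
  apply Finset.sum_bij (fun σ _ => pat p q σ)
  · intro σ h; exact pat_mem p q σ (by simpa using h)
  · intro σ h τ h' e; exact pat_inj p q σ τ (by simpa using h) (by simpa using h') e
  · intro l hl
    obtain ⟨σ, h1, h2⟩ := pat_surj p q l hl
    exact ⟨σ, by simpa using h1, h2⟩
  · intros; rfl

theorem shWord_eq (u v : List V) (σ : Equiv.Perm (Fin (u.length + v.length)))
    (h : IsSh u.length v.length σ) :
    shWord u v σ = FreeMonoid.ofList (merge u v (pat u.length v.length σ)) := by
  rw [shWord]
  congr 1
  have h1 := ofFn_eq_merge _ _ σ h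
  have h2 := congrArg (List.map (fun i => (u ++ v).get
    (Fin.cast (List.length_append (as := u) (bs := v)).symm i))) h1
  rw [map_merge, List.map_ofFn] at h2
  refine Eq.trans h2 ?_
  congr 1
  · apply List.ext_get
    · simp [idxA]
    · intro n h1 h2
      simp [idxA, List.getElem_append_left h2]
  · apply List.ext_get
    · simp [idxB]
    · intro n h1 h2
      simp [idxB]

/-- basis element -/
noncomputable abbrev S (u : List V) : MonoidAlgebra k (FreeMonoid V) :=
  MonoidAlgebra.single (FreeMonoid.ofList u) (1 : k)

theorem S_cons (a : V) (u : List V) : S k (a :: u) = S k [a] * S k u := by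
  rw [S, S, S, MonoidAlgebra.single_mul_single, mul_one]; rfl

theorem S_append (u v : List V) : S k (u ++ v) = S k u * S k v := by
  rw [S, S, S, MonoidAlgebra.single_mul_single, mul_one]; rfl

theorem S_nil : S k ([] : List V) = 1 := rfl

theorem shuffle_eq (u v : List V) :
    shuffleProd k u v = ∑ l ∈ B u.length v.length, S k (merge u v l) := by
  rw [← sum_sh, shuffleProd]
  apply Finset.sum_congr rfl
  intro σ h
  rw [shWord_eq u v σ (by simpa using h)]

theorem cond_iff (fb lb : Bool) (p q : ℕ) (σ : Equiv.Perm (Fin (p + q))) :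
    (∃ h : 0 < p + q, posCond p fb (σ.symm ⟨0, h⟩) ∧
      posCond p lb (σ.symm ⟨p + q - 1, Nat.sub_lt h Nat.one_pos⟩)) ↔
    (pat p q σ).head? = some fb ∧ (pat p q σ).getLast? = some lb := by
  have pc : ∀ (b : Bool) (i : Fin (p + q)), posCond p b i ↔ Q p q i = b := by
    intro b i
    cases b <;> simp [posCond, Q]
  have hlen : (pat p q σ).length = p + q := by simp [pat]
  rw [List.head?_eq_getElem?, List.getLast?_eq_getElem?, hlen]
  simp only [pc]
  constructor
  · rintro ⟨h0, h1, h2⟩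
    rw [List.getElem?_eq_getElem (by omega), List.getElem?_eq_getElem (by omega)]
    simp only [pat, List.getElem_map, List.getElem_ofFn]
    exact ⟨congrArg some h1, congrArg some h2⟩
  · intro hh
    have h0 : 0 < p + q := by
      by_contra hc
      rw [List.getElem?_eq_none (by omega)] at hh
      simp at hh
    rw [List.getElem?_eq_getElem (by omega), List.getElem?_eq_getElem (by omega)] at hh
    simp only [pat, List.getElem_map, List.getElem_ofFn, Option.some.injEq] at hh
    exact ⟨h0, hh.1, hh.2⟩

theorem quad_eq (fb lb : Bool) (u v : List V) :
    quadOp k fb lb u v = ∑ l ∈ B u.length v.length,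
      if l.head? = some fb ∧ l.getLast? = some lb then S k (merge u v l) else 0 := by
  rw [← sum_sh, quadOp, ← Finset.filter_filter, Finset.sum_filter]
  apply Finset.sum_congr rfl
  intro σ h
  rw [shWord_eq u v σ (by simpa using h)]
  congr 1
  rw [eq_iff_iff]
  exact cond_iff fb lb _ _ σ

theorem vee_eq (u v : List V) :
    veeOp k u v = ∑ l ∈ B u.length v.length,
      if l.getLast? = some true then S k (merge u v l) else 0 := by
  rw [veeOp, seOp, swOp, quad_eq, quad_eq, ← Finset.sum_add_distrib]
  apply Finset.sum_congr rfl
  intro l _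
  rcases l with _ | ⟨c, l⟩
  · simp
  · cases c <;> simp

theorem succ_eq (u v : List V) :
    succOp k u v = ∑ l ∈ B u.length v.length,
      if l.head? = some true then S k (merge u v l) else 0 := by
  rw [succOp, neOp, seOp, quad_eq, quad_eq, ← Finset.sum_add_distrib]
  apply Finset.sum_congr rfl
  intro l _
  rcases l with _ | ⟨c, l⟩
  · simp
  · rcases h : (c :: l).getLast? with _ | d
    · simp at h
    · cases d <;> simp

theorem merge_nil_left {α : Type*} (v : List α) :
    merge [] v (List.replicate v.length true) = v := by
  induction v with
  | nil => simp [merge]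
  | cons b v ih => rw [List.length_cons, List.replicate_succ, merge_true, ih]

theorem merge_nil_right {α : Type*} (v : List α) :
    merge v [] (List.replicate v.length false) = v := by
  induction v with
  | nil => simp [merge]
  | cons b v ih => rw [List.length_cons, List.replicate_succ, merge_false, ih]

theorem T_nil (v : List V) : shuffleProd k [] v = S k v := by
  rw [shuffle_eq, List.length_nil, B, Finset.sum_singleton, merge_nil_left]

theorem T_nil' (v : List V) : shuffleProd k v [] = S k v := by
  rcases v with _ | ⟨a, v⟩
  · exact T_nil k []
  · rw [shuffle_eq, List.length_nil, List.length_cons, B, Finset.sum_singleton, ← List.length_cons,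
      merge_nil_right]

theorem T_cons (a b : V) (u v : List V) : shuffleProd k (a :: u) (b :: v) =
    S k [a] * shuffleProd k u (b :: v) + S k [b] * shuffleProd k (a :: u) v := by
  simp only [shuffle_eq, List.length_cons, sum_B_succ, merge_true, merge_false, Finset.mul_sum,
    ← S_cons]

theorem W_nil (v : List V) (hv : v ≠ []) : veeOp k [] v = S k v := by
  rw [vee_eq, List.length_nil, B, Finset.sum_singleton, merge_nil_left]
  rw [List.getLast?_replicate]
  simp [hv]

theorem W_nil' (a : V) (u : List V) : veeOp k (a :: u) [] = 0 := by
  rw [vee_eq, List.length_nil, List.length_cons, B, Finset.sum_singleton]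
  rw [List.getLast?_replicate]
  simp

theorem W_cons (a b : V) (u v : List V) : veeOp k (a :: u) (b :: v) =
    S k [a] * veeOp k u (b :: v) + S k [b] * veeOp k (a :: u) v := by
  simp only [vee_eq, List.length_cons, sum_B_succ, merge_true, merge_false, Finset.mul_sum]
  congr 1
  · apply Finset.sum_congr rfl
    intro l hl
    rw [mem_B] at hl
    have : l ≠ [] := by rintro rfl; simp at hl
    obtain ⟨c, l, rfl⟩ := List.exists_cons_of_ne_nil this
    rw [List.getLast?_cons_cons, mul_ite, mul_zero, S_cons]
  · apply Finset.sum_congr rfl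
    intro l hl
    rw [mem_B] at hl
    have : l ≠ [] := by rintro rfl; simp at hl
    obtain ⟨c, l, rfl⟩ := List.exists_cons_of_ne_nil this
    rw [List.getLast?_cons_cons, mul_ite, mul_zero, S_cons]

theorem C_nil (v : List V) (hv : v ≠ []) : succOp k [] v = S k v := by
  rw [succ_eq, List.length_nil, B, Finset.sum_singleton, merge_nil_left]
  rw [List.head?_replicate]
  simp [hv]

theorem C_cons (a b : V) (u v : List V) : succOp k (a :: u) (b :: v) =
    S k [b] * shuffleProd k (a :: u) v := by
  simp only [shuffle_eq, Finset.mul_sum, ← S_cons]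
  simp [succ_eq, sum_B_succ, merge_true]

theorem part1 (w : List V) : ∀ (u v : List V), v ≠ [] → shuffleProd k u (v ++ w) =
    ∑ i ∈ Finset.range (u.length + 1), veeOp k (u.take i) v * shuffleProd k (u.drop i) w := by
  intro u
  induction u with
  | nil => intro v hv; simp [T_nil, W_nil k v hv, S_append]
  | cons a u ihu =>
    intro v
    induction v with
    | nil => intro h; exact absurd rfl h
    | cons b v ihv =>
      intro hv
      have hW : ∀ u, veeOp k (a :: u) (b :: v) =
          S k [a] * veeOp k u (b :: v) + S k [b] * veeOp k (a :: u) v := by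
        intro u; exact W_cons k a b u v
      rw [List.length_cons, Finset.sum_range_succ']
      simp only [List.take_succ_cons, List.drop_succ_cons, List.take_zero, List.drop_zero, hW,
        add_mul, mul_assoc, Finset.sum_add_distrib, ← Finset.mul_sum]
      rw [← ihu (b :: v) hv, List.cons_append, T_cons, W_nil k _ hv, S_cons k b v, mul_assoc, add_assoc,
        ← mul_add]
      congr 2
      rcases v with _ | ⟨c, v⟩
      · simp [W_nil', S_nil]
      · rw [ihv (by simp), List.length_cons, Finset.sum_range_succ' _ (u.length + 1)]
        simp only [List.take_succ_cons, List.drop_succ_cons, List.take_zero, List.drop_zero]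
        rw [W_nil k _ (by simp)]

theorem part2 (c : V) (w : List V) : ∀ (u v : List V), shuffleProd k u (v ++ c :: w) =
    ∑ i ∈ Finset.range (u.length + 1),
      shuffleProd k (u.take i) v * succOp k (u.drop i) (c :: w) := by
  intro u
  induction u with
  | nil => intro v; simp [T_nil, C_nil k (c :: w) (by simp), S_append k v]
  | cons a u ihu =>
    intro v
    induction v with
    | nil =>
      have h0 := ihu []
      simp only [T_nil', List.nil_append] at h0
      rw [List.length_cons, Finset.sum_range_succ']
      simp only [List.take_succ_cons, List.drop_succ_cons, List.take_zero, List.drop_zero, T_nil',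
        S_cons k a (List.take _ _), mul_assoc, ← Finset.mul_sum]
      rw [← h0, List.nil_append, T_cons, C_cons, S_nil, one_mul]
    | cons b v ihv =>
      rw [List.length_cons, Finset.sum_range_succ']
      simp only [List.take_succ_cons, List.drop_succ_cons, List.take_zero, List.drop_zero, T_cons,
        add_mul, mul_assoc, Finset.sum_add_distrib, ← Finset.mul_sum]
      rw [← ihu (b :: v), List.cons_append, T_cons, T_nil, S_cons k b v, mul_assoc, add_assoc,
        ← mul_add]
      congr 2
      rw [ihv, List.length_cons, Finset.sum_range_succ' _ (u.length + 1)]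
      simp only [List.take_succ_cons, List.drop_succ_cons, List.take_zero, List.drop_zero, T_nil]

end Quadri

theorem statement8 (u v w : List V) (hv : v ≠ []) (hw : w ≠ []) :
    (shuffleProd k u (v ++ w) =
        ∑ i ∈ Finset.range (u.length + 1),
          veeOp k (u.take i) v * shuffleProd k (u.drop i) w) ∧
      (shuffleProd k u (v ++ w) =
        ∑ i ∈ Finset.range (u.length + 1),
          shuffleProd k (u.take i) v * succOp k (u.drop i) w) := by
  refine ⟨Quadri.part1 k w u v hv, ?_⟩
  obtain ⟨c, w, rfl⟩ := List.exists_cons_of_ne_nil hw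
  exact Quadri.part2 k c w u v
end

section
/- Let u be an arbitrary word and v, w nonempty words over V. Then u ∧ (vw) = Σ_{u=u¹u²} (u¹ ∨ v)(u² ∧ w), where vw and the juxtaposition on the right denote concatenation and the sum runs over all cuts of u (with the empty-word conventions for the operations). -/
open Finset MonoidAlgebra TensorProduct

variable (k : Type*) [CommRing k] {V : Type*}

/-- `σ` is increasing on each class of equally labelled indices. -/
def IsLab (n : ℕ) (s : ℕ → Bool) (σ : Equiv.Perm (Fin n)) : Prop :=
  ∀ i j : Fin n, i < j → s i = s j → σ i < σ j

/-- The product of the letters `g` in the order given by `σ`. -/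
def labWord (n : ℕ) (g : ℕ → FreeMonoid V) (σ : Equiv.Perm (Fin n)) : FreeMonoid V :=
  (List.ofFn fun i : Fin n => g (σ.symm i)).prod

open Classical in
/-- Sum of all labelled shuffles. -/
noncomputable def labSum (n : ℕ) (s : ℕ → Bool) (g : ℕ → FreeMonoid V) :
    MonoidAlgebra k (FreeMonoid V) :=
  ∑ σ : Equiv.Perm (Fin n), if IsLab n s σ then MonoidAlgebra.single (labWord n g σ) (1 : k) else 0

open Classical in
/-- Sum of all labelled shuffles whose last letter has label `b`. -/
noncomputable def labSumLast (b : Bool) (n : ℕ) (s : ℕ → Bool) (g : ℕ → FreeMonoid V) :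
    MonoidAlgebra k (FreeMonoid V) :=
  ∑ σ : Equiv.Perm (Fin n),
    if IsLab n s σ ∧ ∃ h : 0 < n, s (σ.symm ⟨n - 1, Nat.sub_lt h Nat.one_pos⟩) = b
    then MonoidAlgebra.single (labWord n g σ) (1 : k) else 0

/-- Skip the index `m`. -/
def skipIdx (m i : ℕ) : ℕ := if i < m then i else i + 1

theorem labSum_congr (n : ℕ) (s s' : ℕ → Bool) (g g' : ℕ → FreeMonoid V)
    (hs : ∀ i < n, s i = s' i) (hg : ∀ i < n, g i = g' i) :
    labSum k n s g = labSum k n s' g' := by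
  unfold labSum
  refine Finset.sum_congr rfl fun σ _ => ?_
  have h1 : IsLab n s σ ↔ IsLab n s' σ := by
    unfold IsLab
    refine forall_congr' fun i => forall_congr' fun j => ?_
    rw [hs i i.2, hs j j.2]
  have h2 : labWord n g σ = labWord n g' σ := by
    unfold labWord
    congr 2
    funext i
    exact hg _ (σ.symm i).2
  classical
  simp only [h1, h2]

theorem labSum_zero (s : ℕ → Bool) (g : ℕ → FreeMonoid V) : labSum k 0 s g = 1 := by
  unfold labSum
  rw [Fintype.sum_unique, if_pos]
  · simp [labWord, MonoidAlgebra.one_def]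
  · intro i; exact i.elim0

theorem labSum_eq_add (n : ℕ) (hn : 0 < n) (s : ℕ → Bool) (g : ℕ → FreeMonoid V) :
    labSum k n s g = labSumLast k false n s g + labSumLast k true n s g := by
  unfold labSum labSumLast
  rw [← Finset.sum_add_distrib]
  refine Finset.sum_congr rfl fun σ _ => ?_
  by_cases h : IsLab n s σ
  · cases h' : s (σ.symm ⟨n - 1, Nat.sub_lt hn Nat.one_pos⟩) <;> simp [h, h', hn]
  · simp [h]

theorem labSumLast_eq_zero (b : Bool) (n : ℕ) (s : ℕ → Bool) (g : ℕ → FreeMonoid V)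
    (h : ∀ i < n, s i ≠ b) : labSumLast k b n s g = 0 := by
  unfold labSumLast
  refine Finset.sum_eq_zero fun σ _ => if_neg ?_
  rintro ⟨-, h0, h1⟩
  exact h _ (Fin.is_lt _) h1

/-- Extend a permutation by sending the new index `m` to the last position. -/
def extPerm {n : ℕ} (m : Fin (n + 1)) (τ : Equiv.Perm (Fin n)) : Equiv.Perm (Fin (n + 1)) :=
  ((finSuccEquiv' m).trans τ.optionCongr).trans finSuccEquivLast.symm

theorem extPerm_self {n : ℕ} (m : Fin (n + 1)) (τ : Equiv.Perm (Fin n)) :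
    extPerm m τ m = Fin.last n := by
  simp [extPerm]

theorem extPerm_succAbove {n : ℕ} (m : Fin (n + 1)) (τ : Equiv.Perm (Fin n)) (j : Fin n) :
    extPerm m τ (m.succAbove j) = (τ j).castSucc := by
  simp [extPerm]

theorem extPerm_injective {n : ℕ} (m : Fin (n + 1)) : Function.Injective (extPerm m) := by
  intro τ τ' h
  ext j
  have := congrArg (fun e => e (m.succAbove j)) h
  simp only [extPerm_succAbove] at this
  exact congrArg Fin.val (Fin.castSucc_injective _ this)

theorem extPerm_surj {n : ℕ} (m : Fin (n + 1)) (σ : Equiv.Perm (Fin (n + 1)))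
    (h : σ m = Fin.last n) : ∃ τ, extPerm m τ = σ := by
  have key : ∀ j : Fin n, σ (m.succAbove j) ≠ Fin.last n := by
    intro j hj
    exact Fin.succAbove_ne m j (σ.injective (hj.trans h.symm))
  let f : Fin n → Fin n := fun j => (σ (m.succAbove j)).castPred (key j)
  have hf : Function.Injective f := by
    intro i j hij
    have := Fin.castPred_inj.mp hij
    exact Fin.succAbove_right_injective (σ.injective this)
  refine ⟨Equiv.ofBijective f (Finite.injective_iff_bijective.mp hf), ?_⟩
  ext i
  refine Fin.succAboveCases m ?_ (fun j => ?_) i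
  · rw [extPerm_self, h]
  · rw [extPerm_succAbove]; simp [f]

theorem val_succAbove_skip {n : ℕ} (m : Fin (n + 1)) (j : Fin n) :
    ((m.succAbove j : Fin (n + 1)) : ℕ) = skipIdx m j := by
  unfold Fin.succAbove skipIdx
  simp only [Fin.lt_def, Fin.val_castSucc]
  split_ifs <;> simp

theorem isLab_extPerm {n : ℕ} (m : Fin (n + 1)) (s : ℕ → Bool) (τ : Equiv.Perm (Fin n))
    (hm : ∀ i : Fin (n + 1), m < i → s i ≠ s m) :
    IsLab (n + 1) s (extPerm m τ) ↔ IsLab n (fun i => s (skipIdx m i)) τ := by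
  constructor
  · intro h i j hij hs
    have := h (m.succAbove i) (m.succAbove j) (by simpa using hij)
      (by simpa only [val_succAbove_skip] using hs)
    simpa [extPerm_succAbove] using this
  · intro h i
    refine Fin.succAboveCases m ?_ (fun a => ?_) i
    · intro j hj hs
      exact absurd hs.symm (hm j hj)
    · intro j
      refine Fin.succAboveCases m ?_ (fun b => ?_) j
      · intro _ _
        rw [extPerm_self, extPerm_succAbove]
        exact Fin.castSucc_lt_last _
      · intro hab hs
        rw [extPerm_succAbove, extPerm_succAbove]
        refine Fin.castSucc_lt_castSucc_iff.mpr (h a b (by simpa using hab) ?_)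
        simpa only [val_succAbove_skip] using hs

theorem labWord_extPerm {n : ℕ} (m : Fin (n + 1)) (g : ℕ → FreeMonoid V)
    (τ : Equiv.Perm (Fin n)) :
    labWord (n + 1) g (extPerm m τ) = labWord n (fun i => g (skipIdx m i)) τ * g m := by
  have h1 : (extPerm m τ).symm (Fin.last n) = m := by
    rw [Equiv.symm_apply_eq, extPerm_self]
  have h2 : ∀ j : Fin n, (extPerm m τ).symm j.castSucc = m.succAbove (τ.symm j) := by
    intro j
    rw [Equiv.symm_apply_eq, extPerm_succAbove, Equiv.apply_symm_apply]
  unfold labWord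
  rw [List.ofFn_succ_last, List.prod_append]
  simp only [h1, h2, val_succAbove_skip, List.prod_singleton]

theorem labSumLast_succ (b : Bool) (n : ℕ) (m : Fin (n + 1)) (s : ℕ → Bool)
    (g : ℕ → FreeMonoid V) (hb : s m = b) (hm : ∀ i : Fin (n + 1), m < i → s i ≠ s m) :
    labSumLast k b (n + 1) s g =
      labSum k n (fun i => s (skipIdx m i)) (fun i => g (skipIdx m i)) *
        MonoidAlgebra.single (g m) (1 : k) := by
  classical
  unfold labSum labSumLast
  rw [Finset.sum_mul]
  symm
  refine Finset.sum_of_injOn (extPerm m) (extPerm_injective m).injOn (by simp) ?_ ?_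
  · intro σ _ hσ
    refine if_neg ?_
    rintro ⟨hl, _, h1⟩
    apply hσ
    have hlast : σ m = Fin.last n := by
      change s (σ.symm (Fin.last n)) = b at h1
      rcases lt_trichotomy (σ.symm (Fin.last n)) m with hlt | heq | hgt
      · have := hl _ _ hlt (h1.trans hb.symm)
        rw [Equiv.apply_symm_apply] at this
        exact absurd this (Fin.le_last _).not_gt
      · rw [← heq, Equiv.apply_symm_apply]
      · exact absurd (h1.trans hb.symm) (hm _ hgt)
    obtain ⟨τ, hτ⟩ := extPerm_surj m σ hlast
    exact ⟨τ, by simp, hτ⟩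
  · intro τ _
    have h1 : (extPerm m τ).symm (Fin.last n) = m := by
      rw [Equiv.symm_apply_eq, extPerm_self]
    have h2 : ∃ h : 0 < n + 1,
        s ((extPerm m τ).symm ⟨n + 1 - 1, Nat.sub_lt h Nat.one_pos⟩) = b := by
      refine ⟨n.succ_pos, ?_⟩
      change s ((extPerm m τ).symm (Fin.last n)) = b
      rw [h1, hb]
    by_cases h : IsLab n (fun i => s (skipIdx m i)) τ
    · rw [if_pos h, if_pos ⟨(isLab_extPerm m s τ hm).mpr h, h2⟩, labWord_extPerm,
        MonoidAlgebra.single_mul_single, one_mul]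
    · rw [if_neg h, if_neg (fun h' => h ((isLab_extPerm m s τ hm).mp h'.1)), zero_mul]

/-- Label function of a pair of words. -/
def pairLab (u : List V) (i : ℕ) : Bool := decide (u.length ≤ i)

/-- Letter function of a pair of words. -/
def pairLet (u v : List V) (i : ℕ) : FreeMonoid V := FreeMonoid.ofList ((u ++ v)[i]?.toList)

/-- The shuffle product, in the labelled form. -/
noncomputable def shSum (u v : List V) : MonoidAlgebra k (FreeMonoid V) :=
  labSum k (u.length + v.length) (pairLab u) (pairLet u v)

theorem isSh_iff_isLab (u v : List V) (σ : Equiv.Perm (Fin (u.length + v.length))) :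
    IsSh u.length v.length σ ↔ IsLab (u.length + v.length) (pairLab u) σ := by
  unfold IsSh IsLab pairLab
  constructor
  · rintro ⟨h1, h2⟩ i j hij hs
    have hs' := decide_eq_decide.mp hs
    by_cases hj : (j : ℕ) < u.length
    · exact h1 i j hij hj
    · exact h2 i j (hs'.mpr (not_lt.mp hj)) hij
  · intro h
    refine ⟨fun i j hij hj => h i j hij ?_, fun i j hi hij => h i j hij ?_⟩
    · rw [decide_eq_decide]; omega
    · rw [decide_eq_decide]; omega

theorem ofList_eq_prod (l : List V) :
    FreeMonoid.ofList l = (l.map fun a => FreeMonoid.ofList [a]).prod := by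
  induction l with
  | nil => rfl
  | cons a l ih => rw [List.map_cons, List.prod_cons, ← ih]; rfl

theorem shWord_eq_s9 (u v : List V) (σ : Equiv.Perm (Fin (u.length + v.length))) :
    shWord u v σ = labWord (u.length + v.length) (pairLet u v) σ := by
  unfold shWord labWord pairLet
  rw [ofList_eq_prod, List.map_ofFn]
  congr 2
  funext i
  have : ((σ.symm i : Fin _) : ℕ) < (u ++ v).length := by
    rw [List.length_append]; exact (σ.symm i).2
  simp

theorem quadOp_add (b : Bool) (u v : List V) :
    quadOp k true b u v + quadOp k false b u v =
      labSumLast k b (u.length + v.length) (pairLab u) (pairLet u v) := by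
  unfold quadOp labSumLast
  rw [Finset.sum_filter, Finset.sum_filter, ← Finset.sum_add_distrib]
  refine Finset.sum_congr rfl fun σ _ => ?_
  rw [shWord_eq_s9]
  classical
  simp only [isSh_iff_isLab]
  by_cases h : IsLab (u.length + v.length) (pairLab u) σ
  swap
  · simp [h]
  by_cases h0 : 0 < u.length + v.length
  swap
  · simp only [h0, IsEmpty.exists_iff, and_false, if_false, add_zero]
  simp only [h, h0, exists_true_left, true_and]
  have hb : posCond u.length b
      (σ.symm ⟨u.length + v.length - 1, Nat.sub_lt h0 Nat.one_pos⟩) ↔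
      pairLab u (σ.symm ⟨u.length + v.length - 1, Nat.sub_lt h0 Nat.one_pos⟩) = b := by
    cases b <;> simp [posCond, pairLab]
  by_cases hc : pairLab u (σ.symm ⟨u.length + v.length - 1, Nat.sub_lt h0 Nat.one_pos⟩) = b
  · by_cases hd : u.length ≤ (σ.symm ⟨0, h0⟩ : Fin _)
    · simp only [hb, hc]
      simp [posCond, hd, not_lt.mpr hd]
    · simp only [hb, hc]
      simp [posCond, hd, not_le.mp hd]
  · simp [hb, hc]

theorem wedgeOp_eq (u v : List V) : wedgeOp k u v =
    labSumLast k false (u.length + v.length) (pairLab u) (pairLet u v) :=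
  quadOp_add k false u v

theorem veeOp_eq_s9 (u v : List V) : veeOp k u v =
    labSumLast k true (u.length + v.length) (pairLab u) (pairLet u v) :=
  quadOp_add k true u v

theorem shSum_nil_nil : shSum k ([] : List V) [] = 1 := labSum_zero k _ _

theorem shSum_eq_add (u v : List V) (h : 0 < u.length + v.length) :
    shSum k u v = wedgeOp k u v + veeOp k u v := by
  rw [wedgeOp_eq, veeOp_eq_s9]; exact labSum_eq_add k _ h _ _

theorem wedgeOp_nil (v : List V) : wedgeOp k [] v = 0 := by
  rw [wedgeOp_eq]
  exact labSumLast_eq_zero k _ _ _ _ (by simp [pairLab])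

theorem veeOp_nil (u : List V) : veeOp k u [] = 0 := by
  rw [veeOp_eq_s9]
  exact labSumLast_eq_zero k _ _ _ _ (by simp [pairLab])

theorem veeOp_concat (u v : List V) (a : V) :
    veeOp k u (v ++ [a]) = shSum k u v * MonoidAlgebra.single (FreeMonoid.of a) (1 : k) := by
  rw [veeOp_eq_s9]
  have hl : u.length + (v ++ [a]).length = (u.length + v.length) + 1 := by simp; omega
  rw [hl, labSumLast_succ k true (u.length + v.length) (Fin.last _)]
  · unfold shSum
    congr 1
    · apply labSum_congr
      · intro i hi; simp [skipIdx, hi]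
      · intro i hi
        simp only [skipIdx, Fin.val_last, hi, if_true, pairLet]
        rw [← List.append_assoc, List.getElem?_append_left (by simpa using hi)]
    · congr 1
      simp only [pairLet, Fin.val_last]
      rw [← List.append_assoc, List.getElem?_append_right (by simp)]
      simp
  · simp [pairLab]
  · intro i hi; exact absurd hi (Fin.le_last _).not_gt

theorem wedgeOp_concat (u v : List V) (a : V) :
    wedgeOp k (u ++ [a]) v = shSum k u v * MonoidAlgebra.single (FreeMonoid.of a) (1 : k) := by
  rw [wedgeOp_eq]
  have hl : (u ++ [a]).length + v.length = (u.length + v.length) + 1 := by simp; omega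
  rw [hl, labSumLast_succ k false (u.length + v.length) ⟨u.length, by omega⟩]
  · unfold shSum
    congr 1
    · apply labSum_congr
      · intro i hi
        simp only [skipIdx, pairLab, List.length_append, List.length_singleton, decide_eq_decide]
        split_ifs <;> omega
      · intro i hi
        simp only [skipIdx, pairLet, List.append_assoc]
        congr 2
        split_ifs with h
        · rw [List.getElem?_append_left h, List.getElem?_append_left h]
        · rw [List.getElem?_append_right (by omega),
            List.getElem?_append_right (by rw [List.length_singleton]; omega),
            List.getElem?_append_right (by omega)]
          congr 1
          rw [List.length_singleton]; omega
    · congr 1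
      simp only [pairLet, List.append_assoc]
      rw [List.getElem?_append_right (by simp)]
      simp
  · simp [pairLab]
  · intro i hi
    have hi' : u.length < (i : ℕ) := hi
    simp [pairLab]; omega

theorem wedge_step (v w u : List V) (a : V)
    (ih : shSum k u (v ++ w) = ∑ i ∈ Finset.range (u.length + 1),
      veeOp k (u.take i) v * shSum k (u.drop i) w) :
    wedgeOp k (u ++ [a]) (v ++ w) = ∑ i ∈ Finset.range ((u ++ [a]).length + 1),
      veeOp k ((u ++ [a]).take i) v * wedgeOp k ((u ++ [a]).drop i) w := by
  rw [Finset.sum_range_succ, List.drop_length, wedgeOp_nil, mul_zero, add_zero,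
    wedgeOp_concat, ih, Finset.sum_mul, List.length_append, List.length_singleton]
  refine Finset.sum_congr rfl fun i hi => ?_
  have hi' : i ≤ u.length := by simpa [Nat.lt_succ_iff] using hi
  rw [List.take_append_of_le_length hi', List.drop_append_of_le_length hi', wedgeOp_concat,
    mul_assoc]

theorem shuffle_cut (v : List V) (hv : v ≠ []) (N : ℕ) : ∀ u w : List V,
    u.length + w.length = N →
    (shSum k u (v ++ w) = ∑ i ∈ Finset.range (u.length + 1),
      veeOp k (u.take i) v * shSum k (u.drop i) w) ∧
    (wedgeOp k u (v ++ w) = ∑ i ∈ Finset.range (u.length + 1),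
      veeOp k (u.take i) v * wedgeOp k (u.drop i) w) := by
  induction N using Nat.strong_induction_on with
  | _ N ih =>
  intro u w hN
  have hW : wedgeOp k u (v ++ w) = ∑ i ∈ Finset.range (u.length + 1),
      veeOp k (u.take i) v * wedgeOp k (u.drop i) w := by
    rcases List.eq_nil_or_concat u with rfl | ⟨u', a, rfl⟩
    · simp [wedgeOp_nil]
    · rw [List.concat_eq_append] at *
      apply wedge_step
      exact (ih (u'.length + w.length) (by rw [← hN]; simp) u' w rfl).1
  refine ⟨?_, hW⟩
  have hvl : 0 < v.length := List.length_pos_iff.mpr hv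
  rw [shSum_eq_add k u (v ++ w) (by simp; omega), hW]
  rcases List.eq_nil_or_concat w with rfl | ⟨w', c, rfl⟩
  · rw [Finset.sum_range_succ, Finset.sum_range_succ, List.drop_length, wedgeOp_nil, mul_zero,
      add_zero, shSum_nil_nil, mul_one, List.take_length, List.append_nil]
    congr 1
    refine Finset.sum_congr rfl fun i hi => ?_
    have hi' := Finset.mem_range.mp hi
    rw [shSum_eq_add k (u.drop i) [] (by simp; omega), veeOp_nil, add_zero]
  · rw [List.concat_eq_append] at *
    have h := (ih (u.length + w'.length) (by rw [← hN]; simp) u w' rfl).1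
    rw [← List.append_assoc, veeOp_concat, h, Finset.sum_mul, ← Finset.sum_add_distrib]
    refine Finset.sum_congr rfl fun i _ => ?_
    rw [shSum_eq_add k (u.drop i) (w' ++ [c]) (by simp), veeOp_concat, mul_add, mul_assoc]

theorem statement9 (u v w : List V) (hv : v ≠ []) (hw : w ≠ []) :
    wedgeOp k u (v ++ w) =
      ∑ i ∈ Finset.range (u.length + 1),
        veeOp k (u.take i) v * wedgeOp k (u.drop i) w := by
  exact (shuffle_cut k v hv _ u w rfl).2
end

section
/- Let u be an arbitrary word and v, w nonempty words over V. Then u ≺ (vw) = Σ_{u=u¹u²} (u¹ ≺ v)(u² ≻ w), where vw and the juxtaposition on the right denote concatenation and the sum runs over all cuts of u (with the empty-word conventions for the operations). -/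
open Finset MonoidAlgebra TensorProduct

variable (k : Type*) [CommRing k] {V : Type*}

/-- Shuffle condition with total size `n` and boundary `p`. -/
def ShP (n p : ℕ) (σ : Equiv.Perm (Fin n)) : Prop :=
  (∀ i j : Fin n, (i : ℕ) < (j : ℕ) → (j : ℕ) < p → σ i < σ j) ∧
  (∀ i j : Fin n, p ≤ (i : ℕ) → (i : ℕ) < (j : ℕ) → σ i < σ j)

/-- Word of a permutation. -/
def wordP {n : ℕ} (g : Fin n → V) (σ : Equiv.Perm (Fin n)) : FreeMonoid V :=
  FreeMonoid.ofList (List.ofFn fun i => g (σ.symm i))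

/-- Extension of a permutation by `c ↦ 0`. -/
def extP {n : ℕ} (c : Fin (n + 1)) (τ : Equiv.Perm (Fin n)) : Equiv.Perm (Fin (n + 1)) :=
  ((finSuccEquiv' c).trans (Equiv.optionCongr τ)).trans (finSuccEquiv' 0).symm

theorem extP_self {n : ℕ} (c : Fin (n + 1)) (τ : Equiv.Perm (Fin n)) : extP c τ c = 0 := by
  simp [extP]

theorem extP_succAbove {n : ℕ} (c : Fin (n + 1)) (τ : Equiv.Perm (Fin n)) (i : Fin n) :
    extP c τ (c.succAbove i) = (τ i).succ := by
  simp [extP]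

theorem extP_symm_zero {n : ℕ} (c : Fin (n + 1)) (τ : Equiv.Perm (Fin n)) :
    (extP c τ).symm 0 = c := by
  rw [Equiv.symm_apply_eq, extP_self]

theorem extP_symm_succ {n : ℕ} (c : Fin (n + 1)) (τ : Equiv.Perm (Fin n)) (i : Fin n) :
    (extP c τ).symm i.succ = c.succAbove (τ.symm i) := by
  rw [Equiv.symm_apply_eq, extP_succAbove]; simp

theorem extP_inj {n : ℕ} (c : Fin (n + 1)) : Function.Injective (extP c) := by
  intro τ τ' h
  ext i : 1
  apply Fin.succ_injective
  rw [← extP_succAbove, ← extP_succAbove, h]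

theorem extP_surj {n : ℕ} (c : Fin (n + 1)) (σ : Equiv.Perm (Fin (n + 1)))
    (h : σ.symm 0 = c) : ∃ τ, extP c τ = σ := by
  have hc : σ c = 0 := by rw [← h]; simp
  have hne : ∀ i, σ (c.succAbove i) ≠ 0 := by
    intro i hi
    rw [← hc] at hi
    exact Fin.succAbove_ne c i (σ.injective hi)
  let f : Fin n → Fin n := fun i => (σ (c.succAbove i)).pred (hne i)
  have hf : Function.Injective f := by
    intro i j hij
    have := Fin.pred_inj.mp hij
    exact Fin.succAbove_right_injective (σ.injective this)
  refine ⟨Equiv.ofBijective f (Finite.injective_iff_bijective.mp hf), ?_⟩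
  ext x : 1
  rcases Fin.eq_self_or_eq_succAbove c x with rfl | ⟨i, rfl⟩
  · rw [extP_self, hc]
  · rw [extP_succAbove]; simp [f]

theorem wordP_extP {n : ℕ} (c : Fin (n + 1)) (τ : Equiv.Perm (Fin n)) (g : Fin (n + 1) → V) :
    wordP g (extP c τ) = FreeMonoid.of (g c) * wordP (fun i => g (c.succAbove i)) τ := by
  unfold wordP
  rw [List.ofFn_succ]
  simp only [extP_symm_zero, extP_symm_succ]
  rfl

theorem ShP_ext_zero {n p : ℕ} (τ : Equiv.Perm (Fin n)) :
    ShP (n + 1) (p + 1) (extP 0 τ) ↔ ShP n p τ := by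
  have h0 : extP 0 τ 0 = 0 := extP_self 0 τ
  have h1 : ∀ i : Fin n, extP 0 τ i.succ = (τ i).succ := fun i => by
    have := extP_succAbove 0 τ i
    simpa using this
  unfold ShP
  simp only [Fin.forall_fin_succ, h0, h1]
  simp

theorem succAbove_val {n : ℕ} (c : Fin (n + 1)) (i : Fin n) :
    (c.succAbove i : ℕ) = if (i : ℕ) < c then (i : ℕ) else i + 1 := by
  unfold Fin.succAbove
  split_ifs <;> simp_all [Fin.lt_def]

theorem ShP_ext {n p : ℕ} (c : Fin (n + 1)) (hc : (c : ℕ) = p) (τ : Equiv.Perm (Fin n)) :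
    ShP (n + 1) p (extP c τ) ↔ ShP n p τ := by
  unfold ShP
  have key : ∀ i j, extP c τ (c.succAbove i) < extP c τ (c.succAbove j) ↔ τ i < τ j := by
    intro i j; rw [extP_succAbove, extP_succAbove]; simp
  constructor
  · rintro ⟨h1, h2⟩
    refine ⟨fun i j hij hj => ?_, fun i j hi hij => ?_⟩
    · rw [← key]; apply h1 <;> simp only [succAbove_val] <;> split_ifs <;> omega
    · rw [← key]; apply h2 <;> simp only [succAbove_val] <;> split_ifs <;> omega
  · rintro ⟨h1, h2⟩
    refine ⟨fun i j hij hj => ?_, fun i j hi hij => ?_⟩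
    · rcases Fin.eq_self_or_eq_succAbove c i with rfl | ⟨i, rfl⟩
      · omega
      rcases Fin.eq_self_or_eq_succAbove c j with rfl | ⟨j, rfl⟩
      · omega
      rw [key]
      simp only [succAbove_val] at hij hj
      apply h1 <;> split_ifs at hij hj <;> omega
    · rcases Fin.eq_self_or_eq_succAbove c j with rfl | ⟨j, rfl⟩
      · omega
      rcases Fin.eq_self_or_eq_succAbove c i with rfl | ⟨i, rfl⟩
      · rw [extP_self, extP_succAbove]; simp
      rw [key]
      simp only [succAbove_val] at hij hi
      apply h2 <;> split_ifs at hij hi <;> omega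

open Classical in
/-- Generic sum over all shuffles. -/
noncomputable def sumP (n p : ℕ) (g : Fin n → V) : MonoidAlgebra k (FreeMonoid V) :=
  ∑ σ ∈ univ.filter (ShP n p), MonoidAlgebra.single (wordP g σ) (1 : k)

open Classical in
/-- Generic sum over shuffles with prescribed origin of the first letter. -/
noncomputable def sumB (n p : ℕ) (fb : Bool) (g : Fin n → V) :
    MonoidAlgebra k (FreeMonoid V) :=
  ∑ σ ∈ univ.filter (fun σ => ShP n p σ ∧ ∃ h : 0 < n, posCond p fb (σ.symm ⟨0, h⟩)),
    MonoidAlgebra.single (wordP g σ) (1 : k)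

open Classical in
theorem sum_ext_aux {n p p' : ℕ} (c : Fin (n + 1)) (fb : Bool) (g : Fin (n + 1) → V)
    (h1 : ∀ τ, ShP (n + 1) p (extP c τ) ↔ ShP n p' τ)
    (h2 : posCond p fb c)
    (h3 : ∀ σ, ShP (n + 1) p σ → posCond p fb (σ.symm 0) → σ.symm 0 = c) :
    sumB k (n + 1) p fb g =
      MonoidAlgebra.single (FreeMonoid.of (g c)) 1 * sumP k n p' (fun i => g (c.succAbove i)) := by
  unfold sumB sumP
  rw [Finset.mul_sum]
  symm
  refine Finset.sum_bij (fun τ _ => extP c τ) ?_ ?_ ?_ ?_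
  · intro τ hτ
    simp only [mem_filter, mem_univ, true_and] at hτ ⊢
    refine ⟨(h1 τ).2 hτ, Nat.succ_pos _, ?_⟩
    have := extP_symm_zero c τ
    rw [show (⟨0, Nat.succ_pos _⟩ : Fin (n + 1)) = 0 from rfl, this]
    exact h2
  · intro a _ b _ h
    exact extP_inj c h
  · intro σ hσ
    simp only [mem_filter, mem_univ, true_and] at hσ
    obtain ⟨hs, h, hp⟩ := hσ
    obtain ⟨τ, rfl⟩ := extP_surj c σ (h3 σ hs hp)
    exact ⟨τ, by simpa using (h1 τ).1 hs, rfl⟩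
  · intro τ _
    rw [wordP_extP, MonoidAlgebra.single_mul_single, one_mul]

theorem sumB_false {n p : ℕ} (g : Fin (n + 1) → V) :
    sumB k (n + 1) (p + 1) false g =
      MonoidAlgebra.single (FreeMonoid.of (g 0)) 1 * sumP k n p (fun i => g i.succ) := by
  rw [sum_ext_aux k 0 false g ShP_ext_zero (by simp [posCond])]
  · simp
  · intro σ hs hp
    by_contra hne
    have := hs.1 0 (σ.symm 0) (Nat.pos_of_ne_zero fun h => hne (Fin.ext h)) hp
    simp at this

theorem sumB_true {n : ℕ} (c : Fin (n + 1)) (g : Fin (n + 1) → V) :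
    sumB k (n + 1) c true g =
      MonoidAlgebra.single (FreeMonoid.of (g c)) 1 * sumP k n c (fun i => g (c.succAbove i)) := by
  rw [sum_ext_aux k c true g (ShP_ext c rfl) (by simp [posCond])]
  intro σ hs hp
  by_contra hne
  have hp' : (c : ℕ) ≤ (σ.symm 0 : Fin (n + 1)) := hp
  have h3 : (c : ℕ) ≠ (σ.symm 0 : Fin (n + 1)) := fun h => hne (Fin.ext h.symm)
  have := hs.2 c (σ.symm 0) le_rfl (by omega)
  simp at this

theorem quad_eq (fb : Bool) (u v : List V) :
    quadOp k fb false u v + quadOp k fb true u v =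
      sumB k (u.length + v.length) u.length fb
        (fun i => (u ++ v).get (Fin.cast (List.length_append (as := u) (bs := v)).symm i)) := by
  classical
  unfold quadOp sumB
  rw [← Finset.sum_union]
  · refine Finset.sum_congr ?_ (fun _ _ => rfl)
    ext σ
    simp only [mem_union, mem_filter, mem_univ, true_and]
    constructor
    · rintro (⟨h, h0, h1, h2⟩ | ⟨h, h0, h1, h2⟩) <;> exact ⟨h, h0, h1⟩
    · rintro ⟨h, h0, h1⟩
      by_cases hl : posCond u.length true (σ.symm ⟨u.length + v.length - 1, Nat.sub_lt h0 Nat.one_pos⟩)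
      · exact Or.inr ⟨h, h0, h1, hl⟩
      · exact Or.inl ⟨h, h0, h1, by simpa [posCond] using hl⟩
  · rw [Finset.disjoint_left]
    intro σ h h'
    rw [mem_filter] at h h'
    simp only [posCond] at h h'
    obtain ⟨_, _, _, _, h⟩ := h
    obtain ⟨_, _, _, _, h'⟩ := h'
    omega

theorem sumP_split {n p : ℕ} (hn : 0 < n) (g : Fin n → V) :
    sumP k n p g = sumB k n p false g + sumB k n p true g := by
  classical
  unfold sumP sumB
  rw [← Finset.sum_union]
  · refine Finset.sum_congr ?_ (fun _ _ => rfl)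
    ext σ
    simp only [mem_union, mem_filter, mem_univ, true_and]
    constructor
    · intro h
      by_cases hl : posCond p true (σ.symm ⟨0, hn⟩)
      · exact Or.inr ⟨h, hn, hl⟩
      · exact Or.inl ⟨h, hn, by simpa [posCond] using hl⟩
    · rintro (h | h) <;> exact h.1
  · rw [Finset.disjoint_left]
    intro σ h h'
    rw [mem_filter] at h h'
    simp only [posCond] at h h'
    obtain ⟨_, _, _, h⟩ := h
    obtain ⟨_, _, _, h'⟩ := h'
    omega

theorem shuffle_eq (u v : List V) :
    shuffleProd k u v = sumP k (u.length + v.length) u.length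
        (fun i => (u ++ v).get (Fin.cast (List.length_append (as := u) (bs := v)).symm i)) := by
  classical
  unfold shuffleProd sumP
  refine Finset.sum_congr ?_ (fun _ _ => rfl)
  ext σ
  simp only [mem_filter, mem_univ, true_and]
  rfl

theorem sumB_cast {n m p : ℕ} (h : n = m) (fb : Bool) (g : Fin n → V) :
    sumB k n p fb g = sumB k m p fb (fun i => g (Fin.cast h.symm i)) := by
  subst h; rfl

theorem prec_cons (a : V) (u v : List V) :
    precOp k (a :: u) v = MonoidAlgebra.single (FreeMonoid.of a) 1 * shuffleProd k u v := by
  unfold precOp nwOp swOp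
  rw [quad_eq, sumB_cast k (show (a :: u).length + v.length = (u.length + v.length) + 1 by
    simp; omega)]
  have := sumB_false k (n := u.length + v.length) (p := u.length) (fun i => ((a :: u) ++ v).get (Fin.cast (by simp) i))
  refine this.trans ?_
  rw [shuffle_eq]
  rfl

theorem succ_cons (b : V) (u v : List V) :
    succOp k u (b :: v) = MonoidAlgebra.single (FreeMonoid.of b) 1 * shuffleProd k u v := by
  unfold succOp neOp seOp
  rw [quad_eq]
  have := sumB_true k (n := u.length + v.length) ⟨u.length, by omega⟩
    (fun i => (u ++ (b :: v)).get (Fin.cast (by simp [add_assoc]) i))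
  refine this.trans ?_
  rw [shuffle_eq]
  congr 2
  · simp
  · funext i
    simp only [List.get_eq_getElem, Fin.val_cast, succAbove_val]
    split_ifs with h
    · rw [List.getElem_append_left h, List.getElem_append_left h]
    · rw [List.getElem_append_right (by omega), List.getElem_append_right (by omega)]
      simp only [show (i : ℕ) + 1 - u.length = (i - u.length) + 1 by omega, List.getElem_cons_succ]

theorem shuffle_split (u v : List V) (h : u ≠ [] ∨ v ≠ []) :
    shuffleProd k u v = precOp k u v + succOp k u v := by
  unfold precOp succOp nwOp swOp neOp seOp
  rw [quad_eq, quad_eq, shuffle_eq]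
  apply sumP_split
  rcases h with h | h <;> have := List.length_pos_of_ne_nil h <;> omega

theorem prec_nil (v : List V) : precOp k [] v = 0 := by
  unfold precOp nwOp swOp quadOp
  simp [posCond]

theorem succ_nil (v : List V) : succOp k v [] = 0 := by
  classical
  unfold succOp neOp seOp
  rw [quad_eq]
  unfold sumB
  apply Finset.sum_eq_zero
  intro σ hσ
  rw [mem_filter] at hσ
  simp only [posCond] at hσ
  obtain ⟨_, _, h, h'⟩ := hσ
  have := (σ.symm ⟨0, h⟩).2
  simp only [List.length_nil] at this
  omega

theorem shuffle_nil : shuffleProd k ([] : List V) [] = 1 := by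
  rw [shuffle_eq]
  unfold sumP
  simp only [List.length_nil]
  rw [Finset.sum_eq_single 1]
  · rfl
  · intro b _ hb
    exact absurd (Equiv.ext fun x => x.elim0) hb
  · intro h
    exact absurd (by simp [ShP]) h

/-- Step for the shuffles starting with a letter of the first word. -/
theorem prec_step (a : V) (u v w : List V)
    (ih : shuffleProd k u (v ++ w) = ∑ i ∈ Finset.range (u.length + 1),
        shuffleProd k (u.take i) v * succOp k (u.drop i) w) :
    precOp k (a :: u) (v ++ w) = ∑ i ∈ Finset.range ((a :: u).length + 1),
        precOp k ((a :: u).take i) v * succOp k ((a :: u).drop i) w := by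
  rw [prec_cons, ih, Finset.mul_sum, List.length_cons, Finset.sum_range_succ' _ (u.length + 1)]
  simp [prec_nil, prec_cons, mul_assoc]

theorem shuffle_append (b : V) (w v u : List V) :
    shuffleProd k u (v ++ b :: w) = ∑ i ∈ Finset.range (u.length + 1),
        shuffleProd k (u.take i) v * succOp k (u.drop i) (b :: w) := by
  induction v generalizing u with
  | nil =>
    induction u with
    | nil =>
      rw [shuffle_split k _ _ (by simp)]
      simp [prec_nil, shuffle_nil]
    | cons a u ih =>
      rw [shuffle_split k _ _ (by simp), prec_step k a u [] (b :: w) ih,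
        Finset.sum_range_succ', Finset.sum_range_succ' (fun i => shuffleProd k _ _ * _)]
      simp [prec_nil, shuffle_nil, shuffle_split, succ_nil]
  | cons c v ihv =>
    have hs : succOp k u (c :: v ++ b :: w) = ∑ i ∈ Finset.range (u.length + 1),
        succOp k (u.take i) (c :: v) * succOp k (u.drop i) (b :: w) := by
      rw [List.cons_append, succ_cons, ihv, Finset.mul_sum]
      simp [succ_cons, mul_assoc]
    rw [shuffle_split k _ _ (by simp), hs]
    simp only [shuffle_split k _ (c :: v) (by simp), add_mul, Finset.sum_add_distrib]
    congr 1
    clear hs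
    induction u with
    | nil => simp [prec_nil]
    | cons a u ih =>
      refine prec_step k a u (c :: v) (b :: w) ?_
      have hs : succOp k u (c :: v ++ b :: w) = ∑ i ∈ Finset.range (u.length + 1),
          succOp k (u.take i) (c :: v) * succOp k (u.drop i) (b :: w) := by
        rw [List.cons_append, succ_cons, ihv, Finset.mul_sum]
        simp [succ_cons, mul_assoc]
      rw [shuffle_split k _ _ (by simp), hs, ih]
      simp only [shuffle_split k _ (c :: v) (by simp), add_mul, Finset.sum_add_distrib]

theorem statement10 (u v w : List V) (hv : v ≠ []) (hw : w ≠ []) :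
    precOp k u (v ++ w) =
      ∑ i ∈ Finset.range (u.length + 1),
        precOp k (u.take i) v * succOp k (u.drop i) w := by
  cases w with
  | nil => exact absurd rfl hw
  | cons b w =>
    cases u with
    | nil => simp [prec_nil]
    | cons a u => exact prec_step k a u v (b :: w) (shuffle_append k b w v u)
end
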